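/- arXiv:1709.06949 — 7 statements merged into one kernel-verified Lean document; each statement's English description precedes it below -/
import Mathlib

section
/- Let α ∈ (2,3) and let γ : ℝ → ℝ³ be a 1-periodic, continuously differentiable curve with |γ'(t)| > 0 for all t, injective on [0,1), and with finite Sobolev–Slobodetskij seminorm [γ']_{(α−1)/2,2} < ∞. Then E_α(γ) < ∞. -/
open MeasureTheory Real Set
open scoped ENNReal NNReal

/-- Arclength `ℓ(u,v) = |∫_u^v |γ'(τ)| dτ|` of the curve `γ` between parameters `u` and `v`. -/
noncomputable def arcl {E : Type*} [NormedAddCommGroup E] [NormedSpace ℝ E]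
    (γ : ℝ → E) (u v : ℝ) : ℝ :=
  |∫ τ in u..v, ‖deriv γ τ‖|

/-- Length `ℒ(γ) = ∫_0^L |γ'(τ)| dτ` of one period of the `L`-periodic curve `γ`. -/
noncomputable def curveLen {E : Type*} [NormedAddCommGroup E] [NormedSpace ℝ E]
    (γ : ℝ → E) (L : ℝ) : ℝ :=
  ∫ τ in (0:ℝ)..L, ‖deriv γ τ‖

/-- Intrinsic distance `d_γ(x,y) = min{ℓ(y,x), ℒ(γ) − ℓ(y,x)}` on an `L`-periodic curve. -/
noncomputable def intrDist {E : Type*} [NormedAddCommGroup E] [NormedSpace ℝ E]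
    (γ : ℝ → E) (L x y : ℝ) : ℝ :=
  min (arcl γ y x) (curveLen γ L - arcl γ y x)

/-- O'Hara's energy
`E_α(γ) = ∫_0^L ∫_{-L/2}^{L/2} (1/|γ(u+w)−γ(u)|^α − 1/d_γ(u+w,u)^α)|γ'(u+w)||γ'(u)| dw du`
for an `L`-periodic curve `γ`, as an extended-real valued integral. -/
noncomputable def oharaE {E : Type*} [NormedAddCommGroup E] [NormedSpace ℝ E]
    (α L : ℝ) (γ : ℝ → E) : ℝ≥0∞ :=
  ∫⁻ p : ℝ × ℝ in Set.Ioc 0 L ×ˢ Set.Ioc (-(L/2)) (L/2),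
    ENNReal.ofReal
      ((1 / ‖γ (p.1 + p.2) - γ p.1‖ ^ α - 1 / intrDist γ L (p.1 + p.2) p.1 ^ α)
        * ‖deriv γ (p.1 + p.2)‖ * ‖deriv γ p.1‖)

/-- The `ρ`-th power of the Sobolev–Slobodetskij seminorm
`[f]_{s,ρ}^ρ = ∫_0^L ∫_{-L/2}^{L/2} |f(u+w) − f(u)|^ρ / |w|^{1+ρs} dw du`
of an `L`-periodic function `f`. -/
noncomputable def sloboP {E : Type*} [NormedAddCommGroup E] [NormedSpace ℝ E]
    (s ρ L : ℝ) (f : ℝ → E) : ℝ≥0∞ :=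
  ∫⁻ p : ℝ × ℝ in Set.Ioc 0 L ×ˢ Set.Ioc (-(L/2)) (L/2),
    ENNReal.ofReal (‖f (p.1 + p.2) - f p.1‖ ^ ρ / |p.2| ^ (1 + ρ * s))

/-- The difference of inverse powers is controlled linearly by the difference of the bases. -/
theorem one_div_rpow_sub_one_div_rpow_le {α a l : ℝ} (hα : α ≤ 3)
    (ha : 0 < a) (hal : a ≤ l) :
    1 / a ^ α - 1 / l ^ α ≤ 3 * (l - a) / (a ^ α * l) := by
  have hl : 0 < l := ha.trans_le hal
  have hx0 : 0 < a / l := div_pos ha hl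
  have hx1 : a / l ≤ 1 := (div_le_one hl).2 hal
  have h3 : (a / l) ^ (3 : ℝ) ≤ (a / l) ^ α := Real.rpow_le_rpow_of_exponent_ge hx0 hx1 hα
  have h3' : (a / l) ^ (3 : ℝ) = (a / l) ^ 3 := by exact_mod_cast Real.rpow_natCast (a / l) 3
  rw [h3', Real.div_rpow ha.le hl.le] at h3
  have haα : 0 < a ^ α := Real.rpow_pos_of_pos ha α
  have hlα : 0 < l ^ α := Real.rpow_pos_of_pos hl α
  have h1 : 1 / a ^ α - 1 / l ^ α = (1 - a ^ α / l ^ α) / a ^ α := by field_simp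
  have h2 : 3 * (l - a) / (a ^ α * l) = 3 * (1 - a / l) / a ^ α := by field_simp
  rw [h1, h2]
  gcongr
  nlinarith [mul_nonneg (sq_nonneg (1 - a / l)) (by linarith : (0 : ℝ) ≤ a / l + 2)]

section Curve

variable {E : Type*} [NormedAddCommGroup E] [InnerProductSpace ℝ E] {γ : ℝ → E}

theorem ContDiff.integral_deriv_add [CompleteSpace E] (hγ : ContDiff ℝ 1 γ) (u w : ℝ) :
    ∫ s in (0 : ℝ)..w, deriv γ (u + s) = γ (u + w) - γ u := by
  rw [intervalIntegral.integral_comp_add_left (fun s => deriv γ s), add_zero]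
  exact intervalIntegral.integral_deriv_eq_sub (fun x _ => (hγ.differentiable one_ne_zero) x)
    ((hγ.continuous_deriv le_rfl).intervalIntegrable _ _)

theorem arcl_add (u w : ℝ) :
    arcl γ u (u + w) = |∫ s in (0 : ℝ)..w, ‖deriv γ (u + s)‖| := by
  rw [intervalIntegral.integral_comp_add_left (fun s => ‖deriv γ s‖), add_zero, arcl]

theorem norm_sub_le_arcl [CompleteSpace E] (hγ : ContDiff ℝ 1 γ) (u w : ℝ) :
    ‖γ (u + w) - γ u‖ ≤ arcl γ u (u + w) := by
  rw [arcl_add, ← hγ.integral_deriv_add]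
  exact intervalIntegral.norm_integral_le_abs_integral_norm

/-- A regular simple closed `C¹` curve satisfies the chord-arc (bi-Lipschitz) lower bound. -/
theorem exists_pos_mul_abs_le_norm_sub [CompleteSpace E] (hγ : ContDiff ℝ 1 γ)
    (hper : Function.Periodic γ 1)
    (hreg : ∀ t, 0 < ‖deriv γ t‖) (hinj : Set.InjOn γ (Set.Ico 0 1)) :
    ∃ c > 0, ∀ u ∈ Set.Icc (0 : ℝ) 1, ∀ w ∈ Set.Icc (-(1 / 2) : ℝ) (1 / 2),
      c * |w| ≤ ‖γ (u + w) - γ u‖ := by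
  let q : ℝ × ℝ → E := fun p => ∫ t in (0 : ℝ)..1, deriv γ (p.1 + p.2 * t)
  have hcont : Continuous (deriv γ) := hγ.continuous_deriv le_rfl
  have hq : Continuous q := by
    apply intervalIntegral.continuous_parametric_intervalIntegral_of_continuous'
    fun_prop
  have hqw : ∀ u w : ℝ, w • q (u, w) = γ (u + w) - γ u := by
    intro u w
    rw [← hγ.integral_deriv_add]
    simp only [q]
    have := intervalIntegral.smul_integral_comp_mul_left (a := 0) (b := 1)
      (fun s => deriv γ (u + s)) w
    rwa [mul_zero, mul_one] at this
  let K : Set (ℝ × ℝ) := Set.Icc (0 : ℝ) 1 ×ˢ Set.Icc (-(1 / 2) : ℝ) (1 / 2)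
  have hK : IsCompact K := isCompact_Icc.prod isCompact_Icc
  have hne : K.Nonempty := ⟨(0, 0), by constructor <;> norm_num⟩
  have hpos : ∀ p ∈ K, 0 < ‖q p‖ := by
    rintro ⟨u, w⟩ ⟨-, hw⟩
    obtain ⟨hw1, hw2⟩ : -(1 / 2) ≤ w ∧ w ≤ 1 / 2 := hw
    rcases eq_or_ne w 0 with rfl | hw0
    · simp only [q, zero_mul, add_zero, intervalIntegral.integral_const, sub_zero, one_smul]
      exact hreg u
    · rw [norm_pos_iff]
      intro h0
      have h1 : γ (u + w) = γ u := by
        rw [← sub_eq_zero, ← hqw, h0, smul_zero]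
      have hfr : ∀ x, γ (Int.fract x) = γ x := by
        intro x
        have := hper.sub_int_mul_eq (x := x) ⌊x⌋
        rwa [mul_one] at this
      have h2 : Int.fract (u + w) = Int.fract u :=
        hinj ⟨Int.fract_nonneg _, Int.fract_lt_one _⟩ ⟨Int.fract_nonneg _, Int.fract_lt_one _⟩
          (by rw [hfr, hfr, h1])
      obtain ⟨z, hz⟩ := Int.fract_eq_fract.1 h2
      have hz' : w = z := by linarith
      have hlt : z < 1 := by
        have : (z : ℝ) < 1 := by linarith
        exact_mod_cast this
      have hgt : -1 < z := by
        have : (-1 : ℝ) < z := by linarith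
        exact_mod_cast this
      have : z = 0 := by omega
      exact hw0 (by rw [hz', this, Int.cast_zero])
  obtain ⟨p, hpK, hp⟩ := hK.exists_isMinOn hne hq.norm.continuousOn
  refine ⟨‖q p‖, hpos p hpK, fun u hu w hw => ?_⟩
  rw [← hqw, norm_smul, Real.norm_eq_abs, mul_comm]
  exact mul_le_mul_of_nonneg_left (hp (show (u, w) ∈ K from ⟨hu, hw⟩)) (abs_nonneg w)

/-- The excess of arclength over chord length is controlled by the oscillation of the
derivative. -/
theorem norm_deriv_mul_arcl_sub_le [CompleteSpace E] (hγ : ContDiff ℝ 1 γ) (u w : ℝ) :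
    ‖deriv γ u‖ * (arcl γ u (u + w) - ‖γ (u + w) - γ u‖) ≤
      (1 / 2) * ∫ s in Set.uIoc 0 w, ‖deriv γ (u + s) - deriv γ u‖ ^ 2 := by
  have hcont : Continuous (deriv γ) := hγ.continuous_deriv le_rfl
  set b := deriv γ u
  have hc1 : Continuous fun s => deriv γ (u + s) := by fun_prop
  have h1 : ‖b‖ * arcl γ u (u + w) = |∫ s in (0 : ℝ)..w, ‖b‖ * ‖deriv γ (u + s)‖| := by
    rw [intervalIntegral.integral_const_mul, abs_mul, abs_norm, arcl_add]
  have h2 : |∫ s in (0 : ℝ)..w, inner ℝ b (deriv γ (u + s))| ≤ ‖b‖ * ‖γ (u + w) - γ u‖ := by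
    have h := (innerSL ℝ b).intervalIntegral_comp_comm
      (hc1.intervalIntegrable (μ := volume) 0 w)
    simp only [innerSL_apply_apply] at h
    rw [h, hγ.integral_deriv_add]
    exact abs_real_inner_le_norm _ _
  calc ‖b‖ * (arcl γ u (u + w) - ‖γ (u + w) - γ u‖)
      ≤ |∫ s in (0 : ℝ)..w, ‖b‖ * ‖deriv γ (u + s)‖|
          - |∫ s in (0 : ℝ)..w, inner ℝ b (deriv γ (u + s))| := by
        rw [mul_sub, h1]; linarith
    _ ≤ |∫ s in (0 : ℝ)..w, (‖b‖ * ‖deriv γ (u + s)‖ - inner ℝ b (deriv γ (u + s)))| := by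
        rw [intervalIntegral.integral_sub]
        · exact abs_sub_abs_le_abs_sub _ _
        · exact Continuous.intervalIntegrable (by fun_prop) _ _
        · exact Continuous.intervalIntegrable (by fun_prop) _ _
    _ ≤ ∫ s in Set.uIoc 0 w, ‖‖b‖ * ‖deriv γ (u + s)‖ - inner ℝ b (deriv γ (u + s))‖ :=
        (Real.norm_eq_abs _).ge.trans intervalIntegral.norm_integral_le_integral_norm_uIoc
    _ ≤ ∫ s in Set.uIoc 0 w, (1 / 2) * ‖deriv γ (u + s) - b‖ ^ 2 := by
        apply integral_mono
        · exact (Continuous.integrableOn_uIoc (by fun_prop))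
        · exact (Continuous.integrableOn_uIoc (by fun_prop))
        · intro s
          simp only
          rw [Real.norm_of_nonneg (sub_nonneg.2 (real_inner_le_norm _ _)), norm_sub_sq_real,
            real_inner_comm]
          nlinarith [sq_nonneg (‖b‖ - ‖deriv γ (u + s)‖)]
    _ = _ := integral_const_mul _ _

theorem mul_abs_le_arcl (hγ : ContDiff ℝ 1 γ) {m : ℝ}
    (hm : ∀ t, m ≤ ‖deriv γ t‖) (u w : ℝ) : m * |w| ≤ arcl γ u (u + w) := by
  have hcont : Continuous (deriv γ) := hγ.continuous_deriv le_rfl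
  have hc1 : Continuous fun s => ‖deriv γ (u + s)‖ := by fun_prop
  rw [arcl_add]
  rcases le_total 0 w with hw | hw
  · rw [abs_of_nonneg hw, abs_of_nonneg
      (intervalIntegral.integral_nonneg hw fun _ _ => norm_nonneg _)]
    have := intervalIntegral.integral_mono (a := 0) (b := w) hw
      (intervalIntegrable_const (μ := volume) (c := m)) (hc1.intervalIntegrable _ _)
      (fun s => hm (u + s))
    simpa [mul_comm] using this
  · rw [intervalIntegral.integral_symm, abs_neg, abs_of_nonpos hw, abs_of_nonneg
      (intervalIntegral.integral_nonneg hw fun _ _ => norm_nonneg _)]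
    have := intervalIntegral.integral_mono (a := w) (b := 0) hw
      (intervalIntegrable_const (μ := volume) (c := m)) (hc1.intervalIntegrable _ _)
      (fun s => hm (u + s))
    simpa [mul_comm] using this

theorem Function.Periodic.deriv' {c : ℝ} (hper : Function.Periodic γ c) :
    Function.Periodic (deriv γ) c := by
  intro x
  rw [← deriv_comp_add_const]
  congr 1
  exact funext hper

theorem arcl_lt_curveLen (hγ : ContDiff ℝ 1 γ) (hper : Function.Periodic γ 1)
    (hreg : ∀ t, 0 < ‖deriv γ t‖) {u w : ℝ} (hw : |w| < 1) :
    arcl γ u (u + w) < curveLen γ 1 := by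
  have hcont : Continuous fun t => ‖deriv γ t‖ := (hγ.continuous_deriv le_rfl).norm
  have hint : ∀ a b : ℝ, IntervalIntegrable (fun t => ‖deriv γ t‖) volume a b :=
    fun a b => hcont.intervalIntegrable a b
  have hP : Function.Periodic (fun t => ‖deriv γ t‖) 1 := fun x => by
    simp only [hper.deriv' x]
  have hlen : ∀ a : ℝ, curveLen γ 1 = ∫ t in a..(a + 1), ‖deriv γ t‖ := by
    intro a
    rw [curveLen, hP.intervalIntegral_add_eq a 0, zero_add]
  have key : ∀ a b : ℝ, a ≤ b → b < a + 1 → |∫ t in a..b, ‖deriv γ t‖| < curveLen γ 1 := by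
    intro a b hab hb
    rw [hlen a, ← intervalIntegral.integral_add_adjacent_intervals (hint a b) (hint b (a + 1)),
      abs_of_nonneg (intervalIntegral.integral_nonneg hab fun _ _ => norm_nonneg _)]
    have := intervalIntegral.intervalIntegral_pos_of_pos (hint b (a + 1)) hreg hb
    linarith
  rw [abs_lt] at hw
  rw [arcl]
  rcases le_total 0 w with h | h
  · exact key _ _ (by linarith) (by linarith)
  · rw [intervalIntegral.integral_symm, abs_neg]
    exact key _ _ (by linarith) (by linarith)

/-- The integrand of O'Hara's energy is controlled by averages of the squared oscillation of the
derivative. -/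
theorem exists_forall_integrand_le [CompleteSpace E] {α : ℝ} (hα₀ : 0 < α) (hα : α ≤ 3)
    (hγ : ContDiff ℝ 1 γ) (hper : Function.Periodic γ 1)
    (hreg : ∀ t, 0 < ‖deriv γ t‖) (hinj : Set.InjOn γ (Set.Ico 0 1)) :
    ∃ K : ℝ, 0 ≤ K ∧ ∀ u ∈ Set.Icc (0 : ℝ) 1, ∀ w ∈ Set.Icc (-(1 / 2) : ℝ) (1 / 2),
      (1 / ‖γ (u + w) - γ u‖ ^ α - 1 / intrDist γ 1 (u + w) u ^ α)
        * ‖deriv γ (u + w)‖ * ‖deriv γ u‖ ≤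
      K * (1 / |w| ^ (α + 1) * ∫ s in Set.uIoc 0 w, ‖deriv γ (u + s) - deriv γ u‖ ^ 2) := by
  have hcont : Continuous fun t => ‖deriv γ t‖ := (hγ.continuous_deriv le_rfl).norm
  have hne : (Set.Icc (0 : ℝ) 1).Nonempty := ⟨0, by norm_num⟩
  have hrep : ∀ t, ∃ s ∈ Set.Icc (0 : ℝ) 1, deriv γ t = deriv γ s := by
    intro t
    obtain ⟨s, hs, h⟩ := hper.deriv'.exists_mem_Ico₀ one_pos t
    exact ⟨s, ⟨hs.1, hs.2.le⟩, h⟩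
  obtain ⟨x, -, hx⟩ := isCompact_Icc.exists_isMinOn hne hcont.continuousOn
  obtain ⟨y, -, hy⟩ := isCompact_Icc.exists_isMaxOn hne hcont.continuousOn
  have hm : ∀ t, ‖deriv γ x‖ ≤ ‖deriv γ t‖ := by
    intro t
    obtain ⟨s, hs, h⟩ := hrep t
    rw [h]
    exact hx hs
  have hM : ∀ t, ‖deriv γ t‖ ≤ ‖deriv γ y‖ := by
    intro t
    obtain ⟨s, hs, h⟩ := hrep t
    rw [h]
    exact hy hs
  obtain ⟨c, hc, hbi⟩ := exists_pos_mul_abs_le_norm_sub hγ hper hreg hinj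
  set m := ‖deriv γ x‖
  set M := ‖deriv γ y‖
  have hm0 : 0 < m := hreg x
  have hM0 : 0 < M := hreg y
  refine ⟨3 * M / (2 * (c ^ α * m)), by positivity, fun u hu w hw => ?_⟩
  have hJ0 : 0 ≤ ∫ s in Set.uIoc 0 w, ‖deriv γ (u + s) - deriv γ u‖ ^ 2 :=
    integral_nonneg fun _ => by positivity
  rcases eq_or_ne w 0 with rfl | hw0
  · have hlen : 0 ≤ curveLen γ 1 :=
      intervalIntegral.integral_nonneg zero_le_one fun _ _ => norm_nonneg _
    simp [intrDist, arcl, hlen, Real.zero_rpow hα₀.ne']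
  have hwpos : 0 < |w| := abs_pos.2 hw0
  have hw1 : |w| < 1 := (abs_le.2 hw).trans_lt (by norm_num)
  have hA := hbi u hu w hw
  have hl := mul_abs_le_arcl hγ hm u w
  have hAl := norm_sub_le_arcl hγ u w
  have hL := arcl_lt_curveLen hγ hper hreg (u := u) hw1
  have hex := norm_deriv_mul_arcl_sub_le hγ u w
  have hd : intrDist γ 1 (u + w) u ≤ arcl γ u (u + w) := min_le_left _ _
  set A := ‖γ (u + w) - γ u‖
  set l := arcl γ u (u + w)
  set d := intrDist γ 1 (u + w) u
  set J := ∫ s in Set.uIoc 0 w, ‖deriv γ (u + s) - deriv γ u‖ ^ 2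
  have hA0 : 0 < A := (by positivity : 0 < c * |w|).trans_le hA
  have hl0 : 0 < l := hA0.trans_le hAl
  have hd0 : 0 < d := lt_min hl0 (sub_pos.2 hL)
  have hdl : 1 / l ^ α ≤ 1 / d ^ α := by gcongr
  have hpow := one_div_rpow_sub_one_div_rpow_le hα hA0 hAl
  have hAα : (c * |w|) ^ α ≤ A ^ α := by gcongr
  calc (1 / A ^ α - 1 / d ^ α) * ‖deriv γ (u + w)‖ * ‖deriv γ u‖
      ≤ (3 * (l - A) / (A ^ α * l)) * M * ‖deriv γ u‖ := by
        have h1 : 0 ≤ 3 * (l - A) / (A ^ α * l) :=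
          div_nonneg (by linarith) (by positivity)
        gcongr
        · linarith
        · exact hM _
    _ = 3 * M * (‖deriv γ u‖ * (l - A)) / (A ^ α * l) := by ring
    _ ≤ 3 * M * (1 / 2 * J) / ((c * |w|) ^ α * (m * |w|)) := by gcongr
    _ = 3 * M / (2 * (c ^ α * m)) * (1 / |w| ^ (α + 1) * J) := by
        rw [Real.mul_rpow hc.le hwpos.le, Real.rpow_add_one hwpos.ne']
        have : 0 < c ^ α := Real.rpow_pos_of_pos hc α
        have : 0 < |w| ^ α := Real.rpow_pos_of_pos hwpos α
        field_simp

end Curve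

theorem lintegral_abs_rpow_le {α r : ℝ} (hα : 0 < α) (hr : 0 < r) :
    ∫⁻ w in {w : ℝ | r ≤ |w|}, ENNReal.ofReal (1 / |w| ^ (α + 1)) ≤
      ENNReal.ofReal (2 / α) * ENNReal.ofReal (1 / r ^ α) := by
  have hsub : {w : ℝ | r ≤ |w|} = Set.Iic (-r) ∪ Set.Ici r := by
    ext w
    simp only [Set.mem_ofPred_eq, Set.mem_union, Set.mem_Iic, Set.mem_Ici, le_abs]
    constructor <;> rintro (h | h)
    · exact Or.inr h
    · exact Or.inl (by linarith)
    · exact Or.inr (by linarith)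
    · exact Or.inl h
  have hIoi : ∫⁻ w in Set.Ici r, ENNReal.ofReal (1 / |w| ^ (α + 1)) =
      ENNReal.ofReal (1 / α) * ENNReal.ofReal (1 / r ^ α) := by
    have hlt : -(α + 1) < -1 := by linarith
    rw [setLIntegral_congr Ioi_ae_eq_Ici.symm]
    have hcongr : ∫⁻ w in Set.Ioi r, ENNReal.ofReal (1 / |w| ^ (α + 1)) =
        ∫⁻ w in Set.Ioi r, ENNReal.ofReal (w ^ (-(α + 1))) := by
      refine setLIntegral_congr_fun measurableSet_Ioi fun w hw => ?_
      have hw0 : 0 < w := hr.trans hw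
      simp only [abs_of_pos hw0, Real.rpow_neg hw0.le, one_div]
    rw [hcongr, ← ofReal_integral_eq_lintegral_ofReal (integrableOn_Ioi_rpow_of_lt hlt hr),
      integral_Ioi_rpow_of_lt hlt hr, ← ENNReal.ofReal_mul (by positivity)]
    · congr 1
      rw [show -(α + 1) + 1 = -α by ring, Real.rpow_neg hr.le]
      field_simp
    · filter_upwards [ae_restrict_mem measurableSet_Ioi] with w hw
      exact Real.rpow_nonneg (hr.trans hw).le _
  have hIic : ∫⁻ w in Set.Iic (-r), ENNReal.ofReal (1 / |w| ^ (α + 1)) =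
      ENNReal.ofReal (1 / α) * ENNReal.ofReal (1 / r ^ α) := by
    rw [← hIoi]
    have := (Measure.measurePreserving_neg (volume : Measure ℝ)).setLIntegral_comp_preimage_emb
      (MeasurableEquiv.neg ℝ).measurableEmbedding
      (fun w => ENNReal.ofReal (1 / |w| ^ (α + 1))) (Set.Ici r)
    simpa using this
  rw [hsub]
  refine (lintegral_union_le _ _ _).trans ?_
  rw [hIic, hIoi, ← add_mul, ← ENNReal.ofReal_add (by positivity) (by positivity)]
  gcongr
  exact le_of_eq (by ring)

/-- A Hardy-type inequality, by Tonelli's theorem. -/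
theorem lintegral_mul_lintegral_abs_le {α : ℝ} (hα : 0 < α) (I : Set ℝ)
    {g : ℝ → ℝ≥0∞} (hg : Measurable g) :
    ∫⁻ w in I, ENNReal.ofReal (1 / |w| ^ (α + 1)) * ∫⁻ s in {s | |s| ≤ |w|} ∩ I, g s ≤
      ENNReal.ofReal (2 / α) * ∫⁻ s in I, g s * ENNReal.ofReal (1 / |s| ^ α) := by
  have hm1 : MeasurableSet {p : ℝ × ℝ | |p.2| ≤ |p.1|} :=
    measurableSet_le (by fun_prop) (by fun_prop)
  let F : ℝ × ℝ → ℝ≥0∞ := {p : ℝ × ℝ | |p.2| ≤ |p.1|}.indicator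
    (fun p => ENNReal.ofReal (1 / |p.1| ^ (α + 1)) * g p.2)
  have hF : Measurable F := Measurable.indicator (by fun_prop) hm1
  calc ∫⁻ w in I, ENNReal.ofReal (1 / |w| ^ (α + 1)) * ∫⁻ s in {s | |s| ≤ |w|} ∩ I, g s
      = ∫⁻ w in I, ∫⁻ s in I, F (w, s) := by
        refine lintegral_congr fun w => ?_
        have hmw : MeasurableSet {s : ℝ | |s| ≤ |w|} := measurableSet_le (by fun_prop) (by fun_prop)
        rw [← Measure.restrict_restrict hmw, ← lintegral_const_mul _ hg,
          ← lintegral_indicator hmw]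
        rfl
    _ = ∫⁻ s in I, ∫⁻ w in I, F (w, s) := lintegral_lintegral_swap (hF.aemeasurable)
    _ ≤ ∫⁻ s in I, ENNReal.ofReal (2 / α) * (g s * ENNReal.ofReal (1 / |s| ^ α)) := by
        apply lintegral_mono_ae
        have h0 : ∀ᵐ s ∂(volume.restrict I), s ≠ (0 : ℝ) :=
          ae_restrict_of_ae (Measure.ae_ne volume 0)
        filter_upwards [h0] with s hs
        have hms : MeasurableSet {w : ℝ | |s| ≤ |w|} := measurableSet_le (by fun_prop) (by fun_prop)
        calc ∫⁻ w in I, F (w, s) ≤ ∫⁻ w, F (w, s) := setLIntegral_le_lintegral _ _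
          _ = ∫⁻ w in {w : ℝ | |s| ≤ |w|}, ENNReal.ofReal (1 / |w| ^ (α + 1)) * g s := by
              rw [← lintegral_indicator hms]
              rfl
          _ = (∫⁻ w in {w : ℝ | |s| ≤ |w|}, ENNReal.ofReal (1 / |w| ^ (α + 1))) * g s :=
              lintegral_mul_const _ (by fun_prop)
          _ ≤ ENNReal.ofReal (2 / α) * ENNReal.ofReal (1 / |s| ^ α) * g s := by
              gcongr
              exact lintegral_abs_rpow_le hα (abs_pos.2 hs)
          _ = _ := by ring
    _ = _ := lintegral_const_mul _ (by fun_prop)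

/-- for `α ∈ (2,3)`, a `1`-periodic continuously differentiable curve `γ` in
`ℝ³` which is regular, injective on `[0,1)`, and whose derivative has finite
Sobolev–Slobodetskij seminorm `[γ']_{(α−1)/2,2} < ∞`, has finite O'Hara energy `E_α(γ) < ∞`. -/
theorem energy_lt_top_of_seminorm_lt_top
    (α : ℝ) (hα : α ∈ Set.Ioo (2:ℝ) 3)
    (γ : ℝ → EuclideanSpace ℝ (Fin 3))
    (hγC1 : ContDiff ℝ 1 γ)
    (hγper : Function.Periodic γ 1)
    (hγreg : ∀ t : ℝ, 0 < ‖deriv γ t‖)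
    (hγinj : Set.InjOn γ (Set.Ico 0 1))
    (hsem : sloboP ((α - 1)/2) 2 1 (deriv γ) < ⊤) :
    oharaE α 1 γ < ⊤ := by
  have hcont : Continuous (deriv γ) := hγC1.continuous_deriv le_rfl
  have hα₀ : 0 < α := by linarith [hα.1]
  obtain ⟨K, hK, hle⟩ := exists_forall_integrand_le hα₀ hα.2.le hγC1 hγper hγreg hγinj
  set I : Set ℝ := Set.Ioc (-(1 / 2)) (1 / 2) with hI
  let G : ℝ → ℝ → ℝ≥0∞ := fun u s => ENNReal.ofReal (‖deriv γ (u + s) - deriv γ u‖ ^ 2)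
  have hG : ∀ u, Measurable (G u) := fun u => by
    have : Continuous fun s => ‖deriv γ (u + s) - deriv γ u‖ ^ 2 := by fun_prop
    exact this.measurable.ennreal_ofReal
  have hprod : (volume : Measure (ℝ × ℝ)).restrict (Set.Ioc 0 1 ×ˢ I) =
      (volume.restrict (Set.Ioc 0 1)).prod (volume.restrict I) := by
    rw [Measure.prod_restrict, Measure.volume_eq_prod]
  have hslobo : sloboP ((α - 1) / 2) 2 1 (deriv γ) =
      ∫⁻ u in Set.Ioc (0 : ℝ) 1, ∫⁻ s in I, G u s * ENNReal.ofReal (1 / |s| ^ α) := by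
    rw [sloboP, ← hI, hprod, lintegral_prod]
    · refine lintegral_congr fun u => lintegral_congr fun s => ?_
      simp only [G]
      rw [← ENNReal.ofReal_mul (by positivity), Real.rpow_two, mul_one_div]
      congr 3
      ring
    · have : Continuous fun p : ℝ × ℝ => ‖deriv γ (p.1 + p.2) - deriv γ p.1‖ := by fun_prop
      have := this.measurable
      fun_prop
  have hpt : ∀ u ∈ Set.Ioc (0 : ℝ) 1, ∀ w ∈ I, ENNReal.ofReal
      ((1 / ‖γ (u + w) - γ u‖ ^ α - 1 / intrDist γ 1 (u + w) u ^ α)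
        * ‖deriv γ (u + w)‖ * ‖deriv γ u‖) ≤
      ENNReal.ofReal K *
        (ENNReal.ofReal (1 / |w| ^ (α + 1)) * ∫⁻ s in {s | |s| ≤ |w|} ∩ I, G u s) := by
    intro u hu w hw
    refine (ENNReal.ofReal_le_ofReal (hle u ⟨hu.1.le, hu.2⟩ w ⟨hw.1.le, hw.2⟩)).trans ?_
    rw [ENNReal.ofReal_mul hK, ENNReal.ofReal_mul (by positivity),
      ofReal_integral_eq_lintegral_ofReal (Continuous.integrableOn_uIoc (by fun_prop))
        (ae_of_all _ fun _ => by positivity)]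
    gcongr
    intro s hs
    rcases Set.mem_uIoc.1 hs with ⟨h1, h2⟩ | ⟨h1, h2⟩
    · exact ⟨abs_le_abs_of_nonneg h1.le h2, by linarith, h2.trans hw.2⟩
    · exact ⟨abs_le_abs_of_nonpos h2 h1.le, hw.1.trans h1, by linarith⟩
  calc oharaE α 1 γ
      ≤ ∫⁻ u in Set.Ioc (0 : ℝ) 1, ∫⁻ w in I, ENNReal.ofReal
          ((1 / ‖γ (u + w) - γ u‖ ^ α - 1 / intrDist γ 1 (u + w) u ^ α)
            * ‖deriv γ (u + w)‖ * ‖deriv γ u‖) := by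
        rw [oharaE, ← hI, hprod]
        exact lintegral_prod_le _
    _ ≤ ∫⁻ u in Set.Ioc (0 : ℝ) 1, ENNReal.ofReal K * (ENNReal.ofReal (2 / α) *
          ∫⁻ s in I, G u s * ENNReal.ofReal (1 / |s| ^ α)) := by
        refine setLIntegral_mono' measurableSet_Ioc fun u hu => ?_
        refine (setLIntegral_mono' measurableSet_Ioc (hpt u hu)).trans ?_
        rw [lintegral_const_mul' _ _ ENNReal.ofReal_ne_top]
        gcongr
        exact lintegral_mul_lintegral_abs_le hα₀ I (hG u)
    _ = ENNReal.ofReal K * (ENNReal.ofReal (2 / α) * sloboP ((α - 1) / 2) 2 1 (deriv γ)) := by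
        rw [lintegral_const_mul' _ _ ENNReal.ofReal_ne_top,
          lintegral_const_mul' _ _ ENNReal.ofReal_ne_top, hslobo]
    _ < ⊤ := ENNReal.mul_lt_top ENNReal.ofReal_lt_top
        (ENNReal.mul_lt_top ENNReal.ofReal_lt_top hsem)
end

section
/- Let α ∈ [2,3), L > 0, B ≥ 1, and let Γ : ℝ → ℝ³ be an L-periodic Lipschitz curve with |Γ'| = 1 a.e. satisfying the bi-Lipschitz estimate (1/B)|w| ≤ |Γ(u+w) − Γ(u)| ≤ |w| for all u ∈ ℝ and all |w| ≤ L/2. Then E_α(Γ) ≤ (1/2)(α+1) B^α [Γ']²_{(α−1)/2,2}. -/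
open MeasureTheory Real Set
open scoped ENNReal NNReal

/-- The intrinsic distance of an arclength parametrized curve is the parameter distance, as long as
the latter is at most half a period. -/
lemma intrDist_add_of_unit_speed {E : Type*} [NormedAddCommGroup E] [NormedSpace ℝ E]
    {γ : ℝ → E} {L : ℝ} (hunit : ∀ᵐ u : ℝ, ‖deriv γ u‖ = 1) (u : ℝ) {w : ℝ}
    (hw : |w| ≤ L / 2) : intrDist γ L (u + w) u = |w| := by
  have hint : ∀ a b : ℝ, ∫ τ in a..b, ‖deriv γ τ‖ = b - a := fun a b => by
    rw [intervalIntegral.integral_congr_ae (g := fun _ => (1 : ℝ))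
      (hunit.mono fun x hx _ => hx)]
    simp
  simp only [intrDist, arcl, curveLen, hint]
  rw [add_sub_cancel_left, sub_zero]
  exact min_eq_left (by linarith)

/-- For a unit speed curve `γ` and a unit vector `v`, the deficit of the difference quotient of `γ`
is controlled by the mean square distance of `γ'` to `v`. -/
lemma one_sub_norm_sub_div_le_integral {E : Type*} [NormedAddCommGroup E] [InnerProductSpace ℝ E]
    {γ : ℝ → E} {K : ℝ≥0} (hlip : LipschitzWith K γ) (hunit : ∀ᵐ u : ℝ, ‖deriv γ u‖ = 1)
    {v : E} (hv : ‖v‖ = 1) (u : ℝ) {w : ℝ} (hw : w ≠ 0) :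
    1 - ‖γ (u + w) - γ u‖ / |w|
      ≤ (1 / 2) * ∫ θ in (0:ℝ)..1, ‖deriv γ (u + w * θ) - v‖ ^ 2 := by
  set g : ℝ → ℝ := fun τ => inner ℝ v (γ τ) with hg
  have hg_lip : LipschitzWith K g := by
    refine LipschitzWith.of_dist_le_mul fun x y => ?_
    rw [Real.dist_eq, hg]
    simp only
    rw [← inner_sub_right]
    refine (abs_real_inner_le_norm _ _).trans ?_
    rw [hv, one_mul, ← dist_eq_norm]
    exact hlip.dist_le_mul x y
  have hg_ac : AbsolutelyContinuousOnInterval g u (u + w) :=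
    (hg_lip.lipschitzOnWith (s := uIcc u (u + w))).absolutelyContinuousOnInterval
  have hae : ∀ᵐ x : ℝ, ‖deriv γ x - v‖ ^ 2 = 2 - 2 * deriv g x := by
    filter_upwards [hunit] with x hx
    have hdiff : DifferentiableAt ℝ γ x := by
      by_contra h
      simp [deriv_zero_of_not_differentiableAt h] at hx
    have hd : HasDerivAt g (inner ℝ v (deriv γ x)) x := by
      simpa using (hasDerivAt_const x v).inner ℝ hdiff.hasDerivAt
    rw [hd.deriv, norm_sub_sq_real, hx, hv, real_inner_comm]
    ring
  have hI : ∫ x in u..(u + w), ‖deriv γ x - v‖ ^ 2 = 2 * w - 2 * inner ℝ v (γ (u + w) - γ u) := by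
    rw [intervalIntegral.integral_congr_ae (hae.mono fun x hx _ => hx),
      intervalIntegral.integral_sub intervalIntegrable_const
        (hg_ac.intervalIntegrable_deriv.const_mul 2),
      intervalIntegral.integral_const_mul, hg_ac.integral_deriv_eq_sub, inner_sub_right]
    simp [hg, mul_comm]
  rw [intervalIntegral.integral_comp_add_mul (fun x => ‖deriv γ x - v‖ ^ 2) hw]
  simp only [mul_zero, add_zero, mul_one, smul_eq_mul]
  rw [hI]
  have hle : inner ℝ v (γ (u + w) - γ u) / w ≤ ‖γ (u + w) - γ u‖ / |w| := by
    refine (le_abs_self _).trans ?_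
    rw [abs_div]
    gcongr
    simpa [hv] using abs_real_inner_le_norm v (γ (u + w) - γ u)
  have : 1 / 2 * (w⁻¹ * (2 * w - 2 * inner ℝ v (γ (u + w) - γ u)))
      = 1 - inner ℝ v (γ (u + w) - γ u) / w := by
    field_simp
  linarith

/-- A linear upper bound for `t ↦ t ^ (-α) - 1` on `[B⁻¹, 1]`. -/
lemma one_div_rpow_sub_one_le {α B t : ℝ} (hα : 1 ≤ α) (hB : 0 < B) (ht : 1 / B ≤ t)
    (ht1 : t ≤ 1) : 1 / t ^ α - 1 ≤ α * B ^ α * (1 - t) := by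
  have ht0 : 0 < t := lt_of_lt_of_le (by positivity) ht
  have hbern : 1 + α * (t - 1) ≤ t ^ α := by
    simpa using one_add_mul_self_le_rpow_one_add (s := t - 1) (by linarith) hα
  have hinv : 1 / t ^ α ≤ B ^ α := by
    rw [one_div, ← Real.inv_rpow ht0.le]
    refine Real.rpow_le_rpow (by positivity) ?_ (by linarith)
    rw [inv_le_comm₀ ht0 hB, ← one_div]
    exact ht
  have hpos : 0 < t ^ α := Real.rpow_pos_of_pos ht0 α
  calc 1 / t ^ α - 1 = (1 / t ^ α) * (1 - t ^ α) := by field_simp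
    _ ≤ (1 / t ^ α) * (α * (1 - t)) := by gcongr; linarith
    _ ≤ B ^ α * (α * (1 - t)) := by
      have : 0 ≤ α * (1 - t) := mul_nonneg (by linarith) (by linarith)
      gcongr
    _ = _ := by ring

/-- Pointwise bound of O'Hara's integrand of a unit speed curve by averaged differences of its
tangent. -/
lemma one_div_rpow_sub_one_div_rpow_le_s3 {E : Type*} [NormedAddCommGroup E] [InnerProductSpace ℝ E]
    {γ : ℝ → E} {K : ℝ≥0} (hlip : LipschitzWith K γ) (hunit : ∀ᵐ u : ℝ, ‖deriv γ u‖ = 1)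
    {α B : ℝ} (hα : 1 ≤ α) (hB : 0 < B) {u w : ℝ} (hu : ‖deriv γ u‖ = 1) (hw : w ≠ 0)
    (hlow : (1 / B) * |w| ≤ ‖γ (u + w) - γ u‖) (hup : ‖γ (u + w) - γ u‖ ≤ |w|) :
    1 / ‖γ (u + w) - γ u‖ ^ α - 1 / |w| ^ α
      ≤ α / 2 * B ^ α
        * ∫ θ in (0:ℝ)..1, ‖deriv γ (u + w * θ) - deriv γ u‖ ^ 2 / |w| ^ α := by
  have hw0 : 0 < |w| := abs_pos.mpr hw
  have hwα : 0 < |w| ^ α := Real.rpow_pos_of_pos hw0 α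
  set x := ‖γ (u + w) - γ u‖
  have hx0 : 0 < x := lt_of_lt_of_le (by positivity) hlow
  have hxα : 0 < x ^ α := Real.rpow_pos_of_pos hx0 α
  have h1 := one_div_rpow_sub_one_le hα hB (t := x / |w|) ((le_div_iff₀ hw0).2 hlow)
    ((div_le_one hw0).2 hup)
  have h2 := one_sub_norm_sub_div_le_integral hlip hunit hu u hw
  rw [intervalIntegral.integral_div]
  set I := ∫ θ in (0:ℝ)..1, ‖deriv γ (u + w * θ) - deriv γ u‖ ^ 2
  calc 1 / x ^ α - 1 / |w| ^ α = (1 / (x / |w|) ^ α - 1) / |w| ^ α := by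
        rw [Real.div_rpow hx0.le hw0.le]; field_simp
    _ ≤ (α * B ^ α * (1 - x / |w|)) / |w| ^ α := by gcongr
    _ ≤ (α * B ^ α * (1 / 2 * I)) / |w| ^ α := by gcongr
    _ = _ := by ring

/-- The integrand of the squared Sobolev–Slobodetskij seminorm is jointly measurable when evaluated
at the derivative of a curve. -/
lemma measurable_slobo_deriv {E : Type*} [NormedAddCommGroup E] [NormedSpace ℝ E]
    [CompleteSpace E] (γ : ℝ → E) (α : ℝ) :
    Measurable fun p : ℝ × ℝ =>
      ENNReal.ofReal (‖deriv γ (p.1 + p.2) - deriv γ p.1‖ ^ 2 / |p.2| ^ α) := by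
  have hf := stronglyMeasurable_deriv γ
  have h1 : Measurable fun p : ℝ × ℝ => ‖deriv γ (p.1 + p.2) - deriv γ p.1‖ :=
    ((hf.comp_measurable (measurable_fst.add measurable_snd)).sub
      (hf.comp_measurable measurable_fst)).norm.measurable
  exact ((h1.pow_const 2).div ((measurable_snd.abs).pow_const α)).ennreal_ofReal

/-- Joint measurability of the rescaled seminorm integrand of a derivative in `((u, w), θ)`. -/
lemma measurable_rescaled_slobo_deriv {E : Type*} [NormedAddCommGroup E] [NormedSpace ℝ E]
    [CompleteSpace E] (γ : ℝ → E) (α : ℝ) :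
    Measurable fun q : (ℝ × ℝ) × ℝ =>
      ENNReal.ofReal (‖deriv γ (q.1.1 + q.1.2 * q.2) - deriv γ q.1.1‖ ^ 2 / |q.1.2| ^ α) := by
  have hf := stronglyMeasurable_deriv γ
  have h1 : Measurable fun q : (ℝ × ℝ) × ℝ =>
      ‖deriv γ (q.1.1 + q.1.2 * q.2) - deriv γ q.1.1‖ :=
    ((hf.comp_measurable (g := fun q : (ℝ × ℝ) × ℝ => q.1.1 + q.1.2 * q.2) (by fun_prop)).sub
      (hf.comp_measurable (g := fun q : (ℝ × ℝ) × ℝ => q.1.1) (by fun_prop))).norm.measurable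
  exact ((h1.pow_const 2).div ((measurable_fst.snd.abs).pow_const α)).ennreal_ofReal

/-- Extended-real form of `one_div_rpow_sub_one_div_rpow_le`. -/
lemma ofReal_one_div_rpow_sub_le_lintegral {E : Type*} [NormedAddCommGroup E]
    [InnerProductSpace ℝ E] [CompleteSpace E]
    {γ : ℝ → E} {K : ℝ≥0} (hlip : LipschitzWith K γ) (hunit : ∀ᵐ u : ℝ, ‖deriv γ u‖ = 1)
    {α B : ℝ} (hα : 1 ≤ α) (hB : 0 < B) {u w : ℝ} (hu : ‖deriv γ u‖ = 1) (hw : w ≠ 0)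
    (hlow : (1 / B) * |w| ≤ ‖γ (u + w) - γ u‖) (hup : ‖γ (u + w) - γ u‖ ≤ |w|) :
    ENNReal.ofReal (1 / ‖γ (u + w) - γ u‖ ^ α - 1 / |w| ^ α)
      ≤ ENNReal.ofReal (α / 2 * B ^ α) * ∫⁻ θ in Ioc (0:ℝ) 1,
        ENNReal.ofReal (‖deriv γ (u + w * θ) - deriv γ u‖ ^ 2 / |w| ^ α) := by
  refine (ENNReal.ofReal_le_ofReal
    (one_div_rpow_sub_one_div_rpow_le_s3 hlip hunit hα hB hu hw hlow hup)).trans ?_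
  rw [ENNReal.ofReal_mul (by positivity), intervalIntegral.integral_of_le zero_le_one]
  gcongr
  have hmeas : Measurable fun θ : ℝ => ‖deriv γ (u + w * θ) - deriv γ u‖ ^ 2 / |w| ^ α :=
    (((((stronglyMeasurable_deriv γ).comp_measurable
      (g := fun θ : ℝ => u + w * θ) (by fun_prop)).sub
        stronglyMeasurable_const).norm.measurable).pow_const 2).div_const _
  rw [integral_eq_lintegral_of_nonneg_ae
    (Filter.Eventually.of_forall fun θ => by positivity) hmeas.aestronglyMeasurable]
  exact ENNReal.ofReal_toReal_le

/-- Contracting the variable by `θ ∈ (0, 1]` in an integral over a symmetric interval. -/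
lemma setLIntegral_comp_mul_le {H : ℝ → ℝ≥0∞} {R θ : ℝ} (hR : 0 ≤ R)
    (hθ : 0 < θ) (hθ1 : θ ≤ 1) :
    ENNReal.ofReal θ * ∫⁻ w in Ioc (-R) R, H (w * θ) ≤ ∫⁻ h in Ioc (-R) R, H h := by
  have hind : ∀ w, (Ioc (-R) R).indicator (fun w => H (w * θ)) w
      ≤ (Ioc (-R) R).indicator H (w * θ) := fun w => by
    by_cases hw : w ∈ Ioc (-R) R
    · have hw' : w * θ ∈ Ioc (-R) R := by
        obtain ⟨h1, h2⟩ := hw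
        constructor
        · rcases le_total 0 w with h | h <;> nlinarith
        · rcases le_total 0 w with h | h <;> nlinarith
      rw [indicator_of_mem hw, indicator_of_mem hw']
    · rw [indicator_of_notMem hw]
      exact zero_le
  rw [← lintegral_indicator measurableSet_Ioc, ← lintegral_indicator measurableSet_Ioc]
  calc ENNReal.ofReal θ * ∫⁻ w, (Ioc (-R) R).indicator (fun w => H (w * θ)) w
      ≤ ENNReal.ofReal θ * ∫⁻ w, (Ioc (-R) R).indicator H (w * θ) := by
        gcongr with w; exact hind w
    _ = ENNReal.ofReal θ * ∫⁻ h, (Ioc (-R) R).indicator H h ∂(volume.map (· * θ)) := by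
        rw [(measurableEmbedding_mulRight₀ hθ.ne').lintegral_map]
    _ = ∫⁻ h, (Ioc (-R) R).indicator H h := by
        conv_rhs => rw [← Real.smul_map_volume_mul_right hθ.ne']
        rw [lintegral_smul_measure, abs_of_pos hθ, smul_eq_mul]

/-- The averaged tangent differences are controlled by the squared seminorm. -/
lemma setLIntegral_rescaled_slobo_le {E : Type*} [NormedAddCommGroup E] [NormedSpace ℝ E]
    (f : ℝ → E) {α R θ u : ℝ} (hα : 1 ≤ α) (hR : 0 ≤ R) (hθ : 0 < θ) (hθ1 : θ ≤ 1) :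
    ∫⁻ w in Ioc (-R) R, ENNReal.ofReal (‖f (u + w * θ) - f u‖ ^ 2 / |w| ^ α)
      ≤ ∫⁻ h in Ioc (-R) R, ENNReal.ofReal (‖f (u + h) - f u‖ ^ 2 / |h| ^ α) := by
  refine le_trans ?_ (setLIntegral_comp_mul_le
    (H := fun h => ENNReal.ofReal (‖f (u + h) - f u‖ ^ 2 / |h| ^ α)) hR hθ hθ1)
  rw [← lintegral_const_mul' _ _ ENNReal.ofReal_ne_top]
  refine lintegral_mono fun w => ?_
  rw [← ENNReal.ofReal_mul hθ.le]
  refine ENNReal.ofReal_le_ofReal ?_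
  rcases eq_or_ne w 0 with rfl | hw
  · simp [Real.zero_rpow (by linarith : α ≠ 0)]
  have hw0 : 0 < |w| := abs_pos.mpr hw
  have hpow : θ ^ α ≤ θ := by
    simpa using Real.rpow_le_rpow_of_exponent_ge hθ hθ1 hα
  have hθα : 0 < θ ^ α := Real.rpow_pos_of_pos hθ α
  have hwα : 0 < |w| ^ α := Real.rpow_pos_of_pos hw0 α
  rw [abs_mul, abs_of_pos hθ, Real.mul_rpow hw0.le hθ.le]
  calc ‖f (u + w * θ) - f u‖ ^ 2 / |w| ^ α
      = θ ^ α * (‖f (u + w * θ) - f u‖ ^ 2 / (|w| ^ α * θ ^ α)) := by field_simp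
    _ ≤ _ := by gcongr

/-- For unit speed curves with `|w| / B ≤ ‖γ (u + w) - γ u‖ ≤ |w|` in an inner product space,
O'Hara's energy is bounded by `α / 2 * B ^ α` times the squared seminorm of the tangent. -/
lemma oharaE_le_mul_sloboP {E : Type*} [NormedAddCommGroup E] [InnerProductSpace ℝ E]
    [CompleteSpace E] {α L B : ℝ} (hα : 1 ≤ α) (hL : 0 < L) (hB0 : 0 < B)
    {γ : ℝ → E} {K : ℝ≥0} (hlip : LipschitzWith K γ) (hunit : ∀ᵐ u : ℝ, ‖deriv γ u‖ = 1)
    (hbiLip : ∀ u w : ℝ, |w| ≤ L / 2 →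
      (1 / B) * |w| ≤ ‖γ (u + w) - γ u‖ ∧ ‖γ (u + w) - γ u‖ ≤ |w|) :
    oharaE α L γ ≤ ENNReal.ofReal (α / 2 * B ^ α) * sloboP ((α - 1) / 2) 2 L (deriv γ) := by
  have hα0 : α ≠ 0 := by linarith
  set S := Set.Ioc 0 L ×ˢ Set.Ioc (-(L/2)) (L/2)
  have hS_meas : MeasurableSet S := measurableSet_Ioc.prod measurableSet_Ioc
  have hbase : ∀ᵐ p : ℝ × ℝ, ‖deriv γ p.1‖ = 1 :=
    Measure.quasiMeasurePreserving_fst.ae hunit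
  have hshift : ∀ᵐ p : ℝ × ℝ, ‖deriv γ (p.1 + p.2)‖ = 1 :=
    (Measure.quasiMeasurePreserving_snd.comp
      (measurePreserving_prod_add volume volume).quasiMeasurePreserving).ae hunit
  set C := α / 2 * B ^ α
  have hpt : ∀ᵐ p : ℝ × ℝ ∂(volume.restrict S),
      ENNReal.ofReal ((1 / ‖γ (p.1 + p.2) - γ p.1‖ ^ α
          - 1 / intrDist γ L (p.1 + p.2) p.1 ^ α) * ‖deriv γ (p.1 + p.2)‖ * ‖deriv γ p.1‖)
        ≤ ENNReal.ofReal C * ∫⁻ θ in Ioc (0:ℝ) 1,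
          ENNReal.ofReal (‖deriv γ (p.1 + p.2 * θ) - deriv γ p.1‖ ^ 2 / |p.2| ^ α) := by
    filter_upwards [ae_restrict_of_ae hbase, ae_restrict_of_ae hshift,
      ae_restrict_mem hS_meas] with p hp1 hp2 hpS
    obtain ⟨u, w⟩ := p
    obtain ⟨-, hw1, hw2⟩ := hpS
    simp only at hp1 hp2 hw1 hw2 ⊢
    have hw : |w| ≤ L / 2 := abs_le.2 ⟨hw1.le, hw2⟩
    rw [hp1, hp2, mul_one, mul_one, intrDist_add_of_unit_speed hunit u hw]
    rcases eq_or_ne w 0 with rfl | hw0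
    · simp [Real.zero_rpow hα0]
    obtain ⟨hlow, hup⟩ := hbiLip u w hw
    exact ofReal_one_div_rpow_sub_le_lintegral hlip hunit hα hB0 hp1 hw0 hlow hup
  have hslobo : sloboP ((α - 1)/2) 2 L (deriv γ)
      = ∫⁻ u in Ioc 0 L, ∫⁻ h in Ioc (-(L/2)) (L/2),
        ENNReal.ofReal (‖deriv γ (u + h) - deriv γ u‖ ^ 2 / |h| ^ α) := by
    have hexp : 1 + 2 * ((α - 1) / 2) = α := by ring
    simp only [sloboP, hexp, Real.rpow_two]
    rw [Measure.volume_eq_prod, ← Measure.prod_restrict,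
      lintegral_prod _ (measurable_slobo_deriv γ α).aemeasurable]
  have hmeas3 := measurable_rescaled_slobo_deriv γ α
  have hscale : ∀ θ ∈ Ioc (0:ℝ) 1,
      ∫⁻ p in S, ENNReal.ofReal (‖deriv γ (p.1 + p.2 * θ) - deriv γ p.1‖ ^ 2 / |p.2| ^ α)
        ≤ sloboP ((α - 1)/2) 2 L (deriv γ) := by
    intro θ hθ
    have hpair : Measurable fun p : ℝ × ℝ => (p, θ) := by fun_prop
    have hm := hmeas3.comp hpair
    simp only [Function.comp_def] at hm
    rw [hslobo, Measure.volume_eq_prod, ← Measure.prod_restrict, lintegral_prod _ hm.aemeasurable]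
    refine lintegral_mono fun u => ?_
    exact setLIntegral_rescaled_slobo_le (u := u) (deriv γ) hα (half_pos hL).le hθ.1 hθ.2
  calc oharaE α L γ
      ≤ ∫⁻ p in S, ENNReal.ofReal C * ∫⁻ θ in Ioc (0:ℝ) 1,
          ENNReal.ofReal (‖deriv γ (p.1 + p.2 * θ) - deriv γ p.1‖ ^ 2 / |p.2| ^ α) :=
        lintegral_mono_ae hpt
    _ = ENNReal.ofReal C * ∫⁻ θ in Ioc (0:ℝ) 1, ∫⁻ p in S,
          ENNReal.ofReal (‖deriv γ (p.1 + p.2 * θ) - deriv γ p.1‖ ^ 2 / |p.2| ^ α) := by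
        rw [lintegral_const_mul' _ _ ENNReal.ofReal_ne_top,
          lintegral_lintegral_swap hmeas3.aemeasurable]
    _ ≤ ENNReal.ofReal C * ∫⁻ _ in Ioc (0:ℝ) 1, sloboP ((α - 1)/2) 2 L (deriv γ) := by
        gcongr 1
        exact setLIntegral_mono' measurableSet_Ioc hscale
    _ = ENNReal.ofReal C * sloboP ((α - 1)/2) 2 L (deriv γ) := by simp

/-- for `α ∈ [2,3)`, an `L`-periodic arclength parametrized Lipschitz curve
`Γ` in `ℝ³` satisfying the bi-Lipschitz estimate `(1/B)|w| ≤ |Γ(u+w) − Γ(u)| ≤ |w|`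
for all `u` and `|w| ≤ L/2` has energy `E_α(Γ) ≤ (1/2)(α+1)B^α [Γ']²_{(α−1)/2,2}`. -/
theorem energy_le_seminorm_of_biLipschitz
    (α L B : ℝ) (hα : α ∈ Set.Ico (2:ℝ) 3) (hL : 0 < L) (hB : 1 ≤ B)
    (Γ : ℝ → EuclideanSpace ℝ (Fin 3)) (K : NNReal) (hΓlip : LipschitzWith K Γ)
    (hΓper : Function.Periodic Γ L)
    (hΓunit : ∀ᵐ u : ℝ, ‖deriv Γ u‖ = 1)
    (hbiLip : ∀ u w : ℝ, |w| ≤ L/2 →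
      (1/B) * |w| ≤ ‖Γ (u + w) - Γ u‖ ∧ ‖Γ (u + w) - Γ u‖ ≤ |w|) :
    oharaE α L Γ
      ≤ ENNReal.ofReal ((1/2) * (α + 1) * B ^ α) * sloboP ((α - 1)/2) 2 L (deriv Γ) := by
  have hB0 : 0 < B := by linarith
  refine (oharaE_le_mul_sloboP (by linarith [hα.1]) hL hB0 hΓlip hΓunit hbiLip).trans ?_
  have hBα : 0 < B ^ α := Real.rpow_pos_of_pos hB0 α
  have hC : α / 2 * B ^ α ≤ (1/2) * (α + 1) * B ^ α := by nlinarith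
  gcongr
end

section
/- Let α ∈ [2,3), n ∈ ℕ, and let γ and γ_i (i ∈ ℕ) be 1-periodic absolutely continuous curves from ℝ to ℝⁿ with |γ'| > 0 a.e. and |γ_i'| > 0 a.e. for every i, such that γ_i(t) → γ(t) as i → ∞ for every t ∈ ℝ. Then E_α is lower semicontinuous along this sequence: E_α(γ) ≤ liminf_{i→∞} E_α(γ_i). -/
open MeasureTheory Real Set
open scoped ENNReal NNReal

/-- A curve `γ : ℝ → E` is absolutely continuous (with derivative `deriv γ`) if its derivative
is interval integrable and the fundamental theorem of calculus holds on every interval. -/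
def AbsolutelyContinuousCurve {E : Type*} [NormedAddCommGroup E] [NormedSpace ℝ E]
    (γ : ℝ → E) : Prop :=
  (∀ a b : ℝ, IntervalIntegrable (deriv γ) MeasureTheory.volume a b) ∧
  ∀ a b : ℝ, γ b - γ a = ∫ τ in a..b, deriv γ τ


section Arclength

open Filter Topology

variable {E : Type*} [NormedAddCommGroup E] [NormedSpace ℝ E] {γ : ℝ → E}

/-- Arclength of `γ` measured from the parameter `0`. -/
noncomputable def arclenParam (γ : ℝ → E) (t : ℝ) : ℝ := ∫ τ in (0:ℝ)..t, ‖deriv γ τ‖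

namespace AbsolutelyContinuousCurve

theorem arclenParam_sub (h : AbsolutelyContinuousCurve γ) (a b : ℝ) :
    arclenParam γ b - arclenParam γ a = ∫ τ in a..b, ‖deriv γ τ‖ :=
  intervalIntegral.integral_interval_sub_left (h.1 0 b).norm (h.1 0 a).norm

theorem norm_sub_le (h : AbsolutelyContinuousCurve γ) {a b : ℝ} (hab : a ≤ b) :
    ‖γ b - γ a‖ ≤ arclenParam γ b - arclenParam γ a := by
  rw [h.2 a b, h.arclenParam_sub]
  exact intervalIntegral.norm_integral_le_integral_norm hab

theorem monotone_arclenParam (h : AbsolutelyContinuousCurve γ) : Monotone (arclenParam γ) :=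
  fun _ _ hab => sub_nonneg.1 ((norm_nonneg _).trans (h.norm_sub_le hab))

theorem norm_sub_le_abs (h : AbsolutelyContinuousCurve γ) (a b : ℝ) :
    ‖γ b - γ a‖ ≤ |arclenParam γ b - arclenParam γ a| := by
  rcases le_total a b with hab | hab
  · exact (h.norm_sub_le hab).trans (le_abs_self _)
  · rw [norm_sub_rev, abs_sub_comm]
    exact (h.norm_sub_le hab).trans (le_abs_self _)

theorem continuous_arclenParam (h : AbsolutelyContinuousCurve γ) : Continuous (arclenParam γ) :=
  intervalIntegral.continuous_primitive (fun a b => (h.1 a b).norm) 0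

theorem continuous (h : AbsolutelyContinuousCurve γ) : Continuous γ := by
  have : γ = fun t => γ 0 + ∫ τ in (0:ℝ)..t, deriv γ τ := by
    ext t
    rw [← h.2 0 t]
    abel
  rw [this]
  exact continuous_const.add (intervalIntegral.continuous_primitive h.1 0)

theorem strictMono_arclenParam (h : AbsolutelyContinuousCurve γ)
    (hreg : ∀ᵐ t : ℝ, 0 < ‖deriv γ t‖) : StrictMono (arclenParam γ) := by
  intro a b hab
  rw [← sub_pos, h.arclenParam_sub]
  refine (intervalIntegral.integral_pos_iff_support_of_nonneg_ae
    (.of_forall fun _ => norm_nonneg _) (h.1 a b).norm).2 ⟨hab, ?_⟩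
  have hsupp : (Function.support fun τ => ‖deriv γ τ‖) =ᵐ[volume] univ := by
    rw [eventuallyEq_univ]
    filter_upwards [hreg] with t ht using ht.ne'
  rw [measure_congr (hsupp.inter (ae_eq_refl (Ioc a b))), univ_inter]
  simpa using hab

end AbsolutelyContinuousCurve

theorem arclenParam_zero : arclenParam γ 0 = 0 := intervalIntegral.integral_same

theorem arclenParam_one : arclenParam γ 1 = curveLen γ 1 := rfl

theorem arcl_eq_abs_sub (h : AbsolutelyContinuousCurve γ) (u v : ℝ) :
    arcl γ u v = |arclenParam γ v - arclenParam γ u| := by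
  rw [h.arclenParam_sub, arcl]

theorem periodic_deriv {T : ℝ} (hper : Function.Periodic γ T) :
    Function.Periodic (deriv γ) T := fun t => by
  rw [← deriv_comp_add_const γ T t]
  congr 1
  exact funext hper

theorem arclenParam_add_one (h : AbsolutelyContinuousCurve γ) (hper : Function.Periodic γ 1)
    (t : ℝ) : arclenParam γ (t + 1) = arclenParam γ t + curveLen γ 1 := by
  have h1 : Function.Periodic (fun t => ‖deriv γ t‖) 1 := fun t => by
    simp only [periodic_deriv hper t]
  have := h1.intervalIntegral_add_eq t 0
  rw [zero_add, ← h.arclenParam_sub] at this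
  rw [curveLen]
  linarith

theorem curveLen_pos (h : AbsolutelyContinuousCurve γ) (hreg : ∀ᵐ t : ℝ, 0 < ‖deriv γ t‖) :
    0 < curveLen γ 1 := by
  have := h.strictMono_arclenParam hreg one_pos
  rwa [arclenParam_zero, arclenParam_one] at this

theorem exists_continuous_inverse_arclenParam (h : AbsolutelyContinuousCurve γ)
    (hper : Function.Periodic γ 1) (hreg : ∀ᵐ t : ℝ, 0 < ‖deriv γ t‖) :
    ∃ σ : ℝ → ℝ, Continuous σ ∧ StrictMono σ ∧ (∀ t, σ (arclenParam γ t) = t) ∧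
      ∀ s, arclenParam γ (σ s) = s := by
  have hL := curveLen_pos h hreg
  have hint (n : ℤ) : arclenParam γ n = n * curveLen γ 1 := by
    have hp : Function.Periodic (fun t => arclenParam γ t - t * curveLen γ 1) 1 := fun t => by
      simp only [arclenParam_add_one h hper]
      ring
    have := hp.int_mul_eq n
    simp only [mul_one, arclenParam_zero] at this
    linarith
  have hsurj : Function.Surjective (arclenParam γ) := fun s => by
    refine mem_range_of_exists_le_of_exists_ge h.continuous_arclenParam
      ⟨(⌊s / curveLen γ 1⌋ : ℤ), ?_⟩ ⟨(⌈s / curveLen γ 1⌉ : ℤ), ?_⟩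
    · rw [hint, ← le_div_iff₀ hL]
      exact Int.floor_le _
    · rw [hint, ← div_le_iff₀ hL]
      exact Int.le_ceil _
  let e := (h.strictMono_arclenParam hreg).orderIsoOfSurjective _ hsurj
  exact ⟨e.symm, e.symm.continuous, e.symm.strictMono, e.symm_apply_apply, e.apply_symm_apply⟩

/-- A curve with a.e. nonvanishing derivative has null level sets. -/
theorem volume_levelSet_eq_zero (hreg : ∀ᵐ t : ℝ, 0 < ‖deriv γ t‖) (c : E) :
    volume {t | γ t = c} = 0 := by
  have hsub : {t | γ t = c} ⊆ {t | ¬ 0 < ‖deriv γ t‖} ∪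
      {t ∈ {t | γ t = c} | 𝓝[{t | γ t = c} ∩ Ioi t] t = ⊥} := by
    intro t ht
    by_cases hd : 0 < ‖deriv γ t‖
    · refine Or.inr ⟨ht, ?_⟩
      have hd' : deriv γ t ≠ 0 := norm_pos_iff.1 hd
      have hne := (differentiableAt_of_deriv_ne_zero hd').hasDerivAt.eventually_ne hd' (c := c)
      rw [← empty_mem_iff_bot]
      have h1 : ∀ᶠ x in 𝓝[{t | γ t = c} ∩ Ioi t] t, γ x ≠ c :=
        hne.filter_mono (nhdsWithin_mono _ fun x hx => ne_of_gt hx.2)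
      filter_upwards [h1, self_mem_nhdsWithin] with x hx hx' using hx hx'.1
    · exact Or.inl hd
  refine measure_mono_null hsub (measure_union_null ?_ ?_)
  · exact ae_iff.1 hreg
  · exact countable_setOfPred_isolated_right_within.measure_zero volume

theorem norm_coe_addCircle {L x : ℝ} (hL : 0 < L) (hx : |x| ≤ L) :
    ‖(x : AddCircle L)‖ = min |x| (L - |x|) := by
  wlog h0 : 0 ≤ x generalizing x
  · have := this (x := -x) (by rwa [abs_neg]) (by linarith)
    rwa [AddCircle.coe_neg, norm_neg, abs_neg] at this
  rw [abs_of_nonneg h0] at *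
  rcases le_total x (L / 2) with h | h
  · rw [min_eq_left (by linarith), (AddCircle.norm_coe_eq_abs_iff L hL.ne').2, abs_of_nonneg h0]
    rwa [abs_of_nonneg h0, abs_of_pos hL]
  · have hc : (x : AddCircle L) = ((x - L : ℝ) : AddCircle L) := by
      rw [AddCircle.coe_sub, AddCircle.coe_period, sub_zero]
    rw [hc, min_eq_right (by linarith), (AddCircle.norm_coe_eq_abs_iff L hL.ne').2,
      abs_of_nonpos (by linarith), neg_sub]
    rw [abs_of_nonpos (by linarith), abs_of_pos hL]
    linarith

theorem intrDist_eq_norm (h : AbsolutelyContinuousCurve γ) (hper : Function.Periodic γ 1)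
    (hreg : ∀ᵐ t : ℝ, 0 < ‖deriv γ t‖) {u v : ℝ} (huv : |v - u| ≤ 1) :
    intrDist γ 1 v u = ‖((arclenParam γ u - arclenParam γ v : ℝ) : AddCircle (curveLen γ 1))‖ := by
  have hmono := h.monotone_arclenParam
  rw [norm_coe_addCircle (curveLen_pos h hreg), intrDist, arcl_eq_abs_sub h, abs_sub_comm]
  rw [abs_le] at huv ⊢
  have h1 := hmono (show v ≤ u + 1 by linarith)
  have h2 := hmono (show u ≤ v + 1 by linarith)
  rw [arclenParam_add_one h hper] at h1 h2
  constructor <;> linarith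

theorem intrDist_pos (h : AbsolutelyContinuousCurve γ) (hper : Function.Periodic γ 1)
    (hreg : ∀ᵐ t : ℝ, 0 < ‖deriv γ t‖) {u v : ℝ} (hne : v ≠ u) (huv : |v - u| < 1) :
    0 < intrDist γ 1 v u := by
  have hmono := h.strictMono_arclenParam hreg
  rw [intrDist, arcl_eq_abs_sub h, lt_min_iff, abs_pos, sub_ne_zero, sub_pos, abs_lt]
  rw [abs_lt] at huv
  have h1 := hmono (show v < u + 1 by linarith)
  have h2 := hmono (show u < v + 1 by linarith)
  rw [arclenParam_add_one h hper] at h1 h2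
  exact ⟨hmono.injective.ne hne, by linarith, by linarith⟩

end Arclength

section ArclengthCoordinates

variable {E : Type*} [NormedAddCommGroup E]

/-- The integrand of O'Hara's energy for a closed curve `Γ` of length `L` in arclength
coordinates, with the value `∞` at double points. -/
noncomputable def arclenKernel (α L : ℝ) (Γ : ℝ → E) (p : ℝ × ℝ) : ℝ≥0∞ :=
  edist (Γ p.1) (Γ p.2) ^ (-α) - ENNReal.ofReal (min |p.1 - p.2| (L - |p.1 - p.2|)) ^ (-α)

/-- O'Hara's energy of a closed curve `Γ` of length `L` in arclength coordinates. -/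
noncomputable def arclenEnergy (α L : ℝ) (Γ : ℝ → E) : ℝ≥0∞ :=
  ∫⁻ p in Ioo 0 L ×ˢ Ioo 0 L, arclenKernel α L Γ p

theorem measurable_arclenKernel (α L : ℝ) {Γ : ℝ → E} (hΓ : Continuous Γ) :
    Measurable (arclenKernel α L Γ) := by
  have h1 : Measurable fun p : ℝ × ℝ => edist (Γ p.1) (Γ p.2) := by
    apply Continuous.measurable
    fun_prop
  unfold arclenKernel
  fun_prop

theorem arclenEnergy_eq_lintegral_lintegral (α L : ℝ) {Γ : ℝ → E} (hΓ : Continuous Γ) :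
    arclenEnergy α L Γ = ∫⁻ s in Ioo 0 L, ∫⁻ t in Ioo 0 L, arclenKernel α L Γ (s, t) := by
  rw [arclenEnergy, Measure.volume_eq_prod, ← Measure.prod_restrict]
  exact lintegral_prod _ (measurable_arclenKernel α L hΓ).aemeasurable

theorem lintegral_Ioc_add_eq_of_periodic {H : ℝ → ℝ≥0∞} (hH : Function.Periodic H 1) (u : ℝ) :
    ∫⁻ w in Ioc (-(1 / 2)) (1 / 2), H (u + w) = ∫⁻ v in Ioc 0 1, H v := by
  have h1 : ∫⁻ w in Ioc (-(1 / 2)) (1 / 2), H (u + w)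
      = ∫⁻ v in Ioc (u - 1 / 2) (u - 1 / 2 + 1), H v := by
    have hp : (fun w => u + w) ⁻¹' Ioc (u - 1 / 2) (u - 1 / 2 + 1) = Ioc (-(1 / 2)) (1 / 2) := by
      rw [preimage_const_add_Ioc]
      congr 1 <;> ring
    rw [← hp]
    exact (measurePreserving_add_left volume u).setLIntegral_comp_preimage_emb
      (measurableEmbedding_addLeft u) _ _
  rw [h1]
  have : VAddInvariantMeasure (AddSubgroup.zmultiples (1 : ℝ)) ℝ volume :=
    ⟨fun c s _ => measure_preimage_add _ _ _⟩
  have h2 := isAddFundamentalDomain_Ioc (one_pos (α := ℝ)) 0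
  rw [zero_add] at h2
  exact (isAddFundamentalDomain_Ioc (one_pos (α := ℝ)) (u - 1 / 2)).setLIntegral_eq h2 H
    hH.map_vadd_zmultiples

theorem ofReal_one_div_rpow_sub {r d : ℝ} (hr : 0 < r) (hd : 0 < d) (α : ℝ) :
    ENNReal.ofReal (1 / r ^ α - 1 / d ^ α)
      = ENNReal.ofReal r ^ (-α) - ENNReal.ofReal d ^ (-α) := by
  rw [ENNReal.ofReal_rpow_of_pos hr, ENNReal.ofReal_rpow_of_pos hd,
    ← ENNReal.ofReal_sub _ (rpow_nonneg hd.le _), rpow_neg hr.le, rpow_neg hd.le, one_div, one_div]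

variable [NormedSpace ℝ E] {γ : ℝ → E}

theorem measurable_enorm_deriv [CompleteSpace E] (γ : ℝ → E) : Measurable fun t => ‖deriv γ t‖ₑ :=
  (stronglyMeasurable_deriv γ).enorm

theorem measurePreserving_arclenParam (h : AbsolutelyContinuousCurve γ)
    (hper : Function.Periodic γ 1) (hreg : ∀ᵐ t : ℝ, 0 < ‖deriv γ t‖) :
    MeasurePreserving (arclenParam γ) (volume.withDensity fun t => ‖deriv γ t‖ₑ) volume := by
  obtain ⟨σ, -, hσm, hσ, hσ'⟩ := exists_continuous_inverse_arclenParam h hper hreg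
  have hm := h.continuous_arclenParam.measurable
  have hIoc (a b : ℝ) (hab : a < b) :
      Measure.map (arclenParam γ) (volume.withDensity fun t => ‖deriv γ t‖ₑ) (Ioc a b)
        = ENNReal.ofReal (b - a) := by
    have hp : arclenParam γ ⁻¹' Ioc a b = Ioc (σ a) (σ b) := by
      ext t
      simp only [mem_preimage, mem_Ioc]
      rw [← hσm.lt_iff_lt, ← hσm.le_iff_le, hσ]
    have hle := hσm.monotone hab.le
    rw [Measure.map_apply hm measurableSet_Ioc, hp, withDensity_apply _ measurableSet_Ioc,
      ← ofReal_integral_norm_eq_lintegral_enorm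
        ((intervalIntegrable_iff_integrableOn_Ioc_of_le hle).1 (h.1 _ _)),
      ← intervalIntegral.integral_of_le hle, ← h.arclenParam_sub, hσ', hσ']
  refine ⟨hm, Measure.ext_of_Ioc' _ _ (fun a b hab => ?_) fun a b hab => ?_⟩
  · rw [hIoc a b hab]
    exact ENNReal.ofReal_ne_top
  · rw [hIoc a b hab, Real.volume_Ioc]

theorem lintegral_comp_arclenParam [CompleteSpace E] (h : AbsolutelyContinuousCurve γ)
    (hper : Function.Periodic γ 1) (hreg : ∀ᵐ t : ℝ, 0 < ‖deriv γ t‖) {G : ℝ → ℝ≥0∞}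
    (hG : Measurable G) :
    ∫⁻ u in Ioc 0 1, G (arclenParam γ u) * ‖deriv γ u‖ₑ
      = ∫⁻ s in Ioo 0 (curveLen γ 1), G s := by
  have hmp := (measurePreserving_arclenParam h hper hreg).restrict_preimage
    (measurableSet_Ioo (a := 0) (b := curveLen γ 1))
  have hp : arclenParam γ ⁻¹' Ioo 0 (curveLen γ 1) = Ioo 0 1 := by
    have hmono := h.strictMono_arclenParam hreg
    ext t
    have h0 := hmono.lt_iff_lt (a := 0) (b := t)
    have h1 := hmono.lt_iff_lt (a := t) (b := 1)
    rw [arclenParam_zero] at h0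
    rw [arclenParam_one] at h1
    rw [mem_preimage, mem_Ioo, h0, h1, mem_Ioo]
  rw [← hmp.lintegral_comp hG, hp, restrict_withDensity measurableSet_Ioo,
    lintegral_withDensity_eq_lintegral_mul (g := fun a => G (arclenParam γ a)) _
      (measurable_enorm_deriv γ) (hG.comp h.continuous_arclenParam.measurable), setLIntegral_congr Ioo_ae_eq_Ioc.symm]
  simp only [Pi.mul_apply, mul_comm]

theorem ae_ne_add (h : AbsolutelyContinuousCurve γ) (hreg : ∀ᵐ t : ℝ, 0 < ‖deriv γ t‖) :
    ∀ᵐ p : ℝ × ℝ, γ (p.1 + p.2) ≠ γ p.1 := by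
  have hc := h.continuous
  rw [ae_iff, Measure.volume_eq_prod, Measure.measure_prod_null]
  · refine .of_forall fun u => ?_
    have : Prod.mk u ⁻¹' {p : ℝ × ℝ | ¬ γ (p.1 + p.2) ≠ γ p.1}
        = (fun w => u + w) ⁻¹' {t | γ t = γ u} := by
      ext w
      simp
    change volume (Prod.mk u ⁻¹' {p : ℝ × ℝ | ¬ γ (p.1 + p.2) ≠ γ p.1}) = 0
    rw [this, measure_preimage_add]
    exact volume_levelSet_eq_zero hreg _
  · simp only [not_not]
    exact (isClosed_eq (by fun_prop) (by fun_prop)).measurableSet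

/-- O'Hara's energy can be computed in arclength coordinates. -/
theorem oharaE_eq_arclenEnergy [CompleteSpace E] (α : ℝ) (h : AbsolutelyContinuousCurve γ)
    (hper : Function.Periodic γ 1) (hreg : ∀ᵐ t : ℝ, 0 < ‖deriv γ t‖) {σ : ℝ → ℝ}
    (hσc : Continuous σ) (hσ : ∀ t, σ (arclenParam γ t) = t) :
    oharaE α 1 γ = arclenEnergy α (curveLen γ 1) (γ ∘ σ) := by
  set L := curveLen γ 1 with hLdef
  set S := arclenParam γ with hSdef
  have hc := h.continuous
  have hSc : Continuous S := h.continuous_arclenParam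
  have hL : 0 < L := curveLen_pos h hreg
  let K (u v : ℝ) : ℝ≥0∞ :=
    edist (γ u) (γ v) ^ (-α) - ENNReal.ofReal ‖((S u - S v : ℝ) : AddCircle L)‖ ^ (-α)
  have hKm : Measurable fun p : ℝ × ℝ => K p.1 p.2 := by
    have h1 : Measurable fun p : ℝ × ℝ => edist (γ p.1) (γ p.2) := by
      apply Continuous.measurable
      fun_prop
    have h2 : Measurable fun p : ℝ × ℝ => ‖((S p.1 - S p.2 : ℝ) : AddCircle L)‖ := by
      apply Continuous.measurable
      exact ((AddCircle.continuous_mk' L).comp (by fun_prop)).norm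
    fun_prop
  have hdm := measurable_enorm_deriv γ
  have hint : oharaE α 1 γ = ∫⁻ p : ℝ × ℝ in Ioc 0 1 ×ˢ Ioc (-(1 / 2)) (1 / 2),
      K p.1 (p.1 + p.2) * ‖deriv γ (p.1 + p.2)‖ₑ * ‖deriv γ p.1‖ₑ := by
    refine setLIntegral_congr_fun_ae (measurableSet_Ioc.prod measurableSet_Ioc) ?_
    filter_upwards [ae_ne_add h hreg] with ⟨u, w⟩ hne ⟨_, hw⟩
    simp only [mem_Ioc] at hw hne
    have hw0 : u + w ≠ u := fun h0 => hne (by rw [h0])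
    have hw1 : |u + w - u| < 1 := by rw [add_sub_cancel_left, abs_lt]; constructor <;> linarith
    have hr : 0 < ‖γ (u + w) - γ u‖ := norm_pos_iff.2 (sub_ne_zero.2 hne)
    have hd := intrDist_pos h hper hreg hw0 hw1
    rw [ENNReal.ofReal_mul' (norm_nonneg _), ENNReal.ofReal_mul' (norm_nonneg _),
      ofReal_norm, ofReal_norm, ofReal_one_div_rpow_sub hr hd,
      intrDist_eq_norm h hper hreg hw1.le, ← dist_eq_norm, dist_comm, ← edist_dist]
  have hinner : ∀ u ∈ Ioc (0 : ℝ) 1, ∫⁻ w in Ioc (-(1 / 2)) (1 / 2),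
      K u (u + w) * ‖deriv γ (u + w)‖ₑ * ‖deriv γ u‖ₑ
        = (∫⁻ t in Ioo 0 L, arclenKernel α L (γ ∘ σ) (S u, t)) * ‖deriv γ u‖ₑ := by
    intro u hu
    have hKu : Measurable (K u) := hKm.comp measurable_prodMk_left
    have hH : Function.Periodic (fun v => K u v * ‖deriv γ v‖ₑ) 1 := fun v => by
      have h1 : ((S u - (S v + L) : ℝ) : AddCircle L) = ((S u - S v : ℝ) : AddCircle L) := by
        rw [← sub_sub, AddCircle.coe_sub, AddCircle.coe_period, sub_zero]
      simp only [K, hper v, periodic_deriv hper v, hSdef, arclenParam_add_one h hper]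
      rw [← hSdef, ← hLdef, h1]
    have hm : Measurable fun w => K u (u + w) * ‖deriv γ (u + w)‖ₑ :=
      (hKu.mul hdm).comp (measurable_const_add u)
    rw [lintegral_mul_const _ hm, lintegral_Ioc_add_eq_of_periodic hH,
      ← lintegral_comp_arclenParam h hper hreg (G := fun t => arclenKernel α L (γ ∘ σ) (S u, t))
        ((measurable_arclenKernel α L (hc.comp hσc)).comp measurable_prodMk_left)]
    congr 1
    refine setLIntegral_congr_fun measurableSet_Ioc fun v hv => ?_
    have hmono := h.monotone_arclenParam
    have h0 : 0 ≤ S u ∧ 0 ≤ S v := by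
      rw [← arclenParam_zero (γ := γ)]
      exact ⟨hmono hu.1.le, hmono hv.1.le⟩
    have h1 : S u ≤ L ∧ S v ≤ L := ⟨hmono hu.2, hmono hv.2⟩
    have habs : |S u - S v| ≤ L := by
      rw [abs_le]
      constructor <;> linarith
    change K u v * ‖deriv γ v‖ₑ = arclenKernel α L (γ ∘ σ) (S u, S v) * ‖deriv γ v‖ₑ
    simp only [K, arclenKernel, Function.comp_apply, S, hσ]
    rw [norm_coe_addCircle hL habs]
  rw [hint, Measure.volume_eq_prod, ← Measure.prod_restrict, lintegral_prod,
    arclenEnergy_eq_lintegral_lintegral _ _ (hc.comp hσc), ← lintegral_comp_arclenParam h hper hreg]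
  · exact setLIntegral_congr_fun measurableSet_Ioc hinner
  · exact (measurable_arclenKernel α L (hc.comp hσc)).lintegral_prod_right'
  · have h1 : Measurable fun p : ℝ × ℝ => K p.1 (p.1 + p.2) :=
      hKm.comp (measurable_fst.prodMk (measurable_fst.add measurable_snd))
    exact ((h1.mul (hdm.comp (measurable_fst.add measurable_snd))).mul
      (hdm.comp measurable_fst)).aemeasurable

end ArclengthCoordinates

section Estimates

open Filter Topology

variable {E : Type*} [NormedAddCommGroup E]

theorem ofReal_le_arclenKernel {α : ℝ} (hα : 0 ≤ α) {L R D : ℝ} {Γ : ℝ → E} {s t : ℝ} (hR : 0 < R)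
    (hD : 0 < D) (hdist : dist (Γ s) (Γ t) ≤ R) (h1 : D ≤ |s - t|) (h2 : D ≤ L - |s - t|) :
    ENNReal.ofReal (R ^ (-α) - D ^ (-α)) ≤ arclenKernel α L Γ (s, t) := by
  rw [ENNReal.ofReal_sub _ (rpow_nonneg hD.le _), ← ENNReal.ofReal_rpow_of_pos hR,
    ← ENNReal.ofReal_rpow_of_pos hD, arclenKernel]
  simp only [ENNReal.rpow_neg]
  gcongr
  · rw [edist_dist]
    exact ENNReal.ofReal_le_ofReal hdist
  · exact le_min h1 h2

theorem arclenKernel_self {α : ℝ} (hα : 0 < α) (L : ℝ) (Γ : ℝ → E) (s : ℝ) (hL : 0 ≤ L) :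
    arclenKernel α L Γ (s, s) = 0 := by
  simp [arclenKernel, hL, ENNReal.zero_rpow_of_neg (neg_lt_zero.2 hα)]

/-- Fatou's lemma for O'Hara's energy in arclength coordinates. -/
theorem arclenEnergy_le_liminf {α : ℝ} (hα : 0 < α) {L : ℝ} {Ls : ℕ → ℝ} {Γ : ℝ → E}
    {Γs : ℕ → ℝ → E} (hLs : Tendsto Ls atTop (𝓝 L)) (hΓs : ∀ i, Continuous (Γs i))
    (h : ∀ s ∈ Ioo 0 L, Tendsto (fun i => Γs i s) atTop (𝓝 (Γ s))) :
    arclenEnergy α L Γ ≤ liminf (fun i => arclenEnergy α (Ls i) (Γs i)) atTop := by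
  have hmeas (L : ℝ) : MeasurableSet (Ioo 0 L ×ˢ Ioo 0 L) := measurableSet_Ioo.prod measurableSet_Ioo
  simp only [arclenEnergy, ← lintegral_indicator (hmeas _)]
  refine le_trans (lintegral_mono fun p => ?_) (lintegral_liminf_le fun i =>
    (measurable_arclenKernel α (Ls i) (hΓs i)).indicator (hmeas _))
  obtain ⟨s, t⟩ := p
  by_cases hp : (s, t) ∈ Ioo 0 L ×ˢ Ioo 0 L
  swap
  · rw [indicator_of_notMem hp]
    exact zero_le
  obtain ⟨hs, ht⟩ := hp
  simp only at hs ht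
  rw [indicator_of_mem (show (s, t) ∈ Ioo 0 L ×ˢ Ioo 0 L from ⟨hs, ht⟩)]
  rcases eq_or_ne s t with rfl | hst
  · rw [arclenKernel_self hα _ _ _ (hs.1.trans hs.2).le]
    exact zero_le
  have hmem : ∀ᶠ i in atTop, (s, t) ∈ Ioo 0 (Ls i) ×ˢ Ioo 0 (Ls i) := by
    filter_upwards [hLs.eventually_const_lt hs.2, hLs.eventually_const_lt ht.2] with i h1 h2
    exact ⟨⟨hs.1, h1⟩, ⟨ht.1, h2⟩⟩
  have hlim : Tendsto (fun i => arclenKernel α (Ls i) (Γs i) (s, t)) atTop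
      (𝓝 (arclenKernel α L Γ (s, t))) := by
    refine ENNReal.Tendsto.sub ?_ ?_ (Or.inr ?_)
    · exact (ENNReal.continuous_rpow_const.tendsto _).comp ((h s hs).edist (h t ht))
    · refine (ENNReal.continuous_rpow_const.tendsto _).comp (ENNReal.tendsto_ofReal ?_)
      exact tendsto_const_nhds.min (hLs.sub_const _)
    · have : 0 < min |s - t| (L - |s - t|) := by
        rw [lt_min_iff, abs_pos, sub_pos, abs_lt, sub_ne_zero]
        exact ⟨hst, by linarith [hs.1, ht.2], by linarith [ht.1, hs.2]⟩
      rw [ENNReal.ofReal_rpow_of_pos this]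
      exact ENNReal.ofReal_ne_top
  refine (hlim.congr' ?_).liminf_eq.ge
  filter_upwards [hmem] with i hi
  rw [indicator_of_mem hi]

/-- Uniform lower bound on the distance of points which are far apart along a curve, in terms
of the energy. -/
theorem exists_le_dist_of_arclenEnergy_le {α : ℝ} (hα : 2 ≤ α) {M : ℝ≥0∞} (hM : M ≠ ∞) {ρ : ℝ}
    (hρ : 0 < ρ) :
    ∃ r > 0, ∀ (L : ℝ) (Γ : ℝ → E), Continuous Γ → (∀ s t, dist (Γ s) (Γ t) ≤ |s - t|) →
      arclenEnergy α L Γ ≤ M → ∀ a b, 0 ≤ a → b ≤ L → ρ ≤ b - a → ρ ≤ L - (b - a) →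
        r ≤ dist (Γ a) (Γ b) := by
  set C : ℝ := (ρ / 2) ^ (-α) with hC
  have hCpos : 0 < C := rpow_pos_of_pos (by positivity) _
  set ε : ℝ := min (min (ρ / 4) (1 / 3)) (1 / (18 * C)) with hε
  have hε0 : 0 < ε := by positivity
  have hε1 : ε ≤ ρ / 4 := (min_le_left _ _).trans (min_le_left _ _)
  have hε2 : ε ≤ 1 / 3 := (min_le_left _ _).trans (min_le_right _ _)
  have hε3 : 18 * C * ε ≤ 1 := by
    rw [mul_comm, ← le_div_iff₀ (by positivity)]
    exact min_le_right _ _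
  set r : ℝ := ε * exp (-(18 * (M.toReal + 1))) with hr
  have hr0 : 0 < r := by positivity
  have hrε : r < ε := by
    refine mul_lt_of_lt_one_right hε0 (exp_lt_one_iff.2 ?_)
    have := M.toReal_nonneg
    linarith
  refine ⟨r, hr0, fun L Γ hΓ hlip hE a b ha hb hab hab' => ?_⟩
  by_contra! hlt
  have hkey : ∀ s ∈ Ioo (a + r) (a + ε), ∀ t ∈ Ioo (b - (s - a)) b,
      ENNReal.ofReal (1 / (18 * (s - a) ^ 2)) ≤ arclenKernel α L Γ (s, t) := by
    intro s hs t ht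
    obtain ⟨hs1, hs2⟩ := hs
    obtain ⟨ht1, ht2⟩ := ht
    set x := s - a with hx
    have hx0 : 0 < x := by linarith
    have hxε : x < ε := by linarith
    have habs : |s - t| = t - s := by rw [abs_sub_comm, abs_of_nonneg (by linarith)]
    refine le_trans (ENNReal.ofReal_le_ofReal ?_) (ofReal_le_arclenKernel (R := 3 * x) (D := ρ / 2)
      (by linarith) (by positivity) (by positivity) ?_ (by linarith) (by linarith))
    · have h1 : (3 * x) ^ (-2 : ℝ) ≤ (3 * x) ^ (-α) :=
        rpow_le_rpow_of_exponent_ge (by positivity) (by linarith) (by linarith)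
      have h2 : (3 * x) ^ (-2 : ℝ) = 1 / (9 * x ^ 2) := by
        rw [rpow_neg (by positivity), rpow_two, mul_pow, one_div]
        norm_num
      have h3 : C ≤ 1 / (18 * x ^ 2) := by
        rw [le_div_iff₀ (by positivity)]
        have : x ^ 2 ≤ ε := by nlinarith
        nlinarith
      have h4 : 1 / (9 * x ^ 2) = 1 / (18 * x ^ 2) + 1 / (18 * x ^ 2) := by
        field_simp
        norm_num
      linarith
    · have h1 := dist_triangle4 (Γ s) (Γ a) (Γ b) (Γ t)
      have h2 := hlip s a
      have h3 := hlip b t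
      rw [abs_of_nonneg (by linarith)] at h2 h3
      linarith
  have hlow : ENNReal.ofReal (M.toReal + 1) ≤ arclenEnergy α L Γ := by
    calc ENNReal.ofReal (M.toReal + 1)
        = ∫⁻ s in Ioo (a + r) (a + ε), ENNReal.ofReal (1 / 18 * (s - a)⁻¹) := by
          rw [← ofReal_integral_eq_lintegral_ofReal, ← integral_Ioc_eq_integral_Ioo,
            ← intervalIntegral.integral_of_le (by linarith),
            intervalIntegral.integral_const_mul,
            intervalIntegral.integral_comp_sub_right (fun x => x⁻¹), add_sub_cancel_left,
            add_sub_cancel_left, integral_inv_of_pos hr0 hε0, hr, div_mul_cancel_left₀ hε0.ne',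
            ← exp_neg, log_exp]
          · congr 1
            ring
          · refine IntegrableOn.mono_set (ContinuousOn.integrableOn_Icc ?_) Ioo_subset_Icc_self
            refine continuousOn_const.mul (ContinuousOn.inv₀ (by fun_prop) fun s hs => ?_)
            linarith [hs.1]
          · refine (ae_restrict_mem measurableSet_Ioo).mono fun s hs => ?_
            have : 0 < s - a := by linarith [hs.1]
            positivity
      _ ≤ ∫⁻ s in Ioo (a + r) (a + ε), ∫⁻ t in Ioo 0 L, arclenKernel α L Γ (s, t) := by
          refine setLIntegral_mono' measurableSet_Ioo fun s hs => ?_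
          have hx : 0 < s - a := by linarith [hs.1]
          calc ENNReal.ofReal (1 / 18 * (s - a)⁻¹)
              = ∫⁻ t in Ioo (b - (s - a)) b, ENNReal.ofReal (1 / (18 * (s - a) ^ 2)) := by
                rw [setLIntegral_const, Real.volume_Ioo, ← ENNReal.ofReal_mul (by positivity)]
                congr 1
                rw [sub_sub_cancel]
                field_simp
            _ ≤ ∫⁻ t in Ioo (b - (s - a)) b, arclenKernel α L Γ (s, t) :=
                setLIntegral_mono' measurableSet_Ioo (hkey s hs)
            _ ≤ _ := lintegral_mono_set (Ioo_subset_Ioo (by linarith [hs.2]) hb)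
      _ ≤ ∫⁻ s in Ioo 0 L, ∫⁻ t in Ioo 0 L, arclenKernel α L Γ (s, t) :=
          lintegral_mono_set (Ioo_subset_Ioo (by linarith) (by linarith))
      _ = arclenEnergy α L Γ := (arclenEnergy_eq_lintegral_lintegral α L hΓ).symm
  have := hlow.trans hE
  rw [ENNReal.ofReal_le_iff_le_toReal hM] at this
  linarith

/-- If a curve on `[0, L]` has finite energy with respect to the arclength of `[0, L]`, then any
primitive `A` of its arclength which grows at most with unit speed grows with unit speed. -/
theorem sub_eq_length_of_arclenEnergy_ne_top {α : ℝ} (hα : 1 ≤ α) {L : ℝ} (hL : 0 < L) {Γ : ℝ → E}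
    (hΓ : Continuous Γ) {A : ℝ → ℝ} (hA : ∀ s t, s ≤ t → A t - A s ≤ t - s)
    (hΓA : ∀ s t, s ≤ t → dist (Γ s) (Γ t) ≤ A t - A s) (hfin : arclenEnergy α L Γ ≠ ∞) :
    A L - A 0 = L := by
  have hlip : LipschitzWith 1 A := LipschitzWith.of_le_add fun s t => by
    rcases le_total s t with h | h
    · have := dist_nonneg.trans (hΓA s t h)
      linarith [dist_nonneg (x := s) (y := t)]
    · have := hA t s h
      rw [Real.dist_eq, abs_of_nonneg (by linarith)]
      linarith
  rw [arclenEnergy_eq_lintegral_lintegral α L hΓ] at hfin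
  have hfin' := ae_lt_top (measurable_arclenKernel α L hΓ).lintegral_prod_right' hfin
  rw [ae_restrict_iff' measurableSet_Ioo] at hfin'
  have hderiv : ∀ᵐ s, s ∈ Ioo 0 L → deriv A s = 1 := by
    filter_upwards [hfin', hlip.ae_differentiableAt_real] with s hs hd hsL
    refine le_antisymm ((le_abs_self _).trans (norm_deriv_le_of_lipschitz hlip)) ?_
    by_contra! hlt
    obtain ⟨q, hq, hq1⟩ := exists_between (max_lt hlt one_pos)
    obtain ⟨hq, hq0⟩ := max_lt_iff.1 hq
    have hslope : ∀ᶠ t in 𝓝[>] s, slope A s t < q :=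
      (hasDerivWithinAt_iff_tendsto_slope' self_notMem_Ioi).1 hd.hasDerivAt.hasDerivWithinAt
        |>.eventually_lt_const hq
    obtain ⟨u, hu, hsub⟩ := mem_nhdsGT_iff_exists_Ioo_subset.1 hslope
    set b := min (min u L) (min (s + L / 2) (s + 1)) with hb
    have hsb : s < b := by
      simp only [hb, lt_min_iff]
      exact ⟨⟨hu, hsL.2⟩, by linarith, by linarith⟩
    have hb1 : b ≤ u := (min_le_left _ _).trans (min_le_left _ _)
    have hb2 : b ≤ L := (min_le_left _ _).trans (min_le_right _ _)
    have hb3 : b ≤ s + L / 2 := (min_le_right _ _).trans (min_le_left _ _)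
    have hb4 : b ≤ s + 1 := (min_le_right _ _).trans (min_le_right _ _)
    set κ := q ^ (-α) - 1 with hκ
    have hκ0 : 0 < κ := sub_pos.2 (one_lt_rpow_of_pos_of_lt_one_of_neg hq0 hq1 (by linarith))
    have hkey : ∀ t ∈ Ioo s b, ENNReal.ofReal (κ * (t - s)⁻¹) ≤ arclenKernel α L Γ (s, t) := by
      intro t ht
      have hts : 0 < t - s := sub_pos.2 ht.1
      have habs : |s - t| = t - s := by rw [abs_sub_comm, abs_of_pos hts]
      refine le_trans (ENNReal.ofReal_le_ofReal ?_) (ofReal_le_arclenKernel (R := q * (t - s))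
        (D := t - s) (by linarith) (by positivity) hts ?_ habs.ge (by linarith [ht.2]))
      · rw [mul_rpow hq0.le hts.le, ← sub_one_mul]
        gcongr
        rw [← rpow_neg_one]
        exact rpow_le_rpow_of_exponent_ge hts (by linarith [ht.2]) (by linarith)
      · have h1 : slope A s t < q := hsub ⟨ht.1, ht.2.trans_le hb1⟩
        rw [slope_def_field, div_lt_iff₀ hts] at h1
        exact (hΓA s t ht.1.le).trans h1.le
    have hlt : ∫⁻ t in Ioo s b, ENNReal.ofReal (κ * (t - s)⁻¹) < ∞ :=
      ((setLIntegral_mono' measurableSet_Ioo hkey).trans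
        (lintegral_mono_set (Ioo_subset_Ioo hsL.1.le hb2))).trans_lt (hs hsL)
    have hint : IntegrableOn (fun t => κ * (t - s)⁻¹) (Ioo s b) := by
      refine ⟨Measurable.aestronglyMeasurable (by fun_prop), ?_⟩
      rw [hasFiniteIntegral_iff_ofReal]
      · exact hlt
      · refine (ae_restrict_mem measurableSet_Ioo).mono fun t ht => ?_
        have : 0 < t - s := sub_pos.2 ht.1
        positivity
    have hint' : IntervalIntegrable (fun t => (t - s)⁻¹) volume s b := by
      rw [intervalIntegrable_iff_integrableOn_Ioo_of_le hsb.le]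
      simpa [IntegrableOn, hκ0.ne'] using hint.const_mul κ⁻¹
    rw [intervalIntegrable_sub_inv_iff] at hint'
    exact hint'.elim hsb.ne fun h => h left_mem_uIcc
  rw [← (hlip.lipschitzOnWith (s := uIcc 0 L)).absolutelyContinuousOnInterval.integral_deriv_eq_sub,
    intervalIntegral.integral_of_le hL.le, integral_Ioc_eq_integral_Ioo,
    setIntegral_congr_ae (g := fun _ => (1 : ℝ)) measurableSet_Ioo hderiv]
  simp [hL.le]

end Estimates

section Selection

open Filter Topology

/-- Helly's selection theorem for monotone functions which are equicontinuous in the limit. -/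
theorem exists_subseq_tendsto_of_monotone {F : ℕ → ℝ → ℝ} (hF : ∀ i, Monotone (F i))
    (h0 : ∀ i, F i 0 = 0)
    (heq : ∀ ρ > 0, ∃ δ > 0, ∀ u v, u ≤ v → v - u < δ → ∀ᶠ i in atTop, F i v - F i u < ρ) :
    ∃ φ : ℕ → ℕ, StrictMono φ ∧ ∃ S : ℝ → ℝ, Monotone S ∧ Continuous S ∧
      ∀ t, Tendsto (fun i => F (φ i) t) atTop (𝓝 (S t)) := by
  have hbdd (t : ℝ) : ∃ B, ∀ i, F i t ∈ Icc (-B) B := by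
    obtain ⟨δ, hδ, hδ'⟩ := heq 1 one_pos
    have hpos (k : ℕ) : ∀ᶠ i in atTop, F i (k * (δ / 2)) ≤ k ∧ -k ≤ F i (-(k * (δ / 2))) := by
      induction k with
      | zero => exact .of_forall fun i => by simp [h0]
      | succ k ih =>
        filter_upwards [ih, hδ' (k * (δ / 2)) ((k + 1 : ℕ) * (δ / 2)) (by push_cast; linarith)
          (by push_cast; linarith), hδ' (-((k + 1 : ℕ) * (δ / 2))) (-(k * (δ / 2)))
          (by push_cast; linarith) (by push_cast; linarith)] with i h1 h2 h3
        push_cast at h2 h3 ⊢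
        constructor <;> linarith
    obtain ⟨k, hk⟩ := exists_nat_ge (|t| / (δ / 2))
    rw [div_le_iff₀ (by positivity), abs_le] at hk
    have hb : IsBoundedUnder (· ≤ ·) atTop fun i => |F i t| := by
      refine isBoundedUnder_of_eventually_le (a := (k : ℝ)) ?_
      filter_upwards [hpos k] with i hi
      rw [abs_le]
      exact ⟨hi.2.trans (hF i hk.1), (hF i hk.2).trans hi.1⟩
    obtain ⟨B, hB⟩ := hb.bddAbove_range
    exact ⟨B, fun i => abs_le.1 (hB (mem_range_self i))⟩
  choose B hB using hbdd
  obtain ⟨g, -, φ, hφ, hg⟩ := (isCompact_univ_pi fun q : ℚ => isCompact_Icc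
    (a := -B q) (b := B q)).tendsto_subseq (x := fun i (q : ℚ) => F i q) fun i q _ => hB q i
  rw [tendsto_pi_nhds] at hg
  have hlim (t : ℝ) : ∃ s, Tendsto (fun i => F (φ i) t) atTop (𝓝 s) := by
    refine cauchySeq_tendsto_of_complete (Metric.cauchySeq_iff'.2 fun ε hε => ?_)
    obtain ⟨δ, hδ, hδ'⟩ := heq (ε / 4) (by positivity)
    obtain ⟨q, hq1, hq2⟩ := exists_rat_btwn (show t - δ < t by linarith)
    have h1 := hφ.tendsto_atTop.eventually (hδ' q t hq2.le (by linarith))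
    have h2 := Metric.tendsto_nhds.1 (hg q) (ε / 8) (by positivity)
    obtain ⟨N, hN⟩ := eventually_atTop.1 (h1.and h2)
    refine ⟨N, fun i hi => ?_⟩
    obtain ⟨a1, a2⟩ := hN i hi
    obtain ⟨b1, b2⟩ := hN N le_rfl
    have a3 := hF (φ i) hq2.le
    have b3 := hF (φ N) hq2.le
    simp only [Function.comp_apply, Real.dist_eq, abs_lt] at a2 b2 ⊢
    constructor <;> linarith
  choose S hS using hlim
  have hmono : Monotone S := fun u v huv => le_of_tendsto_of_tendsto' (hS u) (hS v) fun i =>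
    hF _ huv
  refine ⟨φ, hφ, S, hmono, ?_, hS⟩
  rw [Metric.continuous_iff]
  intro t ε hε
  obtain ⟨δ, hδ, hδ'⟩ := heq (ε / 2) (by positivity)
  have key (u v : ℝ) (huv : u ≤ v) (hd : v - u < δ) : S v - S u ≤ ε / 2 :=
    le_of_tendsto ((hS v).sub (hS u)) ((hφ.tendsto_atTop.eventually (hδ' u v huv hd)).mono
      fun i hi => hi.le)
  refine ⟨δ, hδ, fun u hu => ?_⟩
  rw [Real.dist_eq, abs_lt] at hu ⊢
  rcases le_total u t with h | h
  · have h1 := key u t h (by linarith)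
    have h2 := hmono h
    constructor <;> linarith
  · have h1 := key t u h (by linarith)
    have h2 := hmono h
    constructor <;> linarith

end Selection

section LowerSemicontinuity

open Filter Topology

variable {E : Type*} [NormedAddCommGroup E] [NormedSpace ℝ E]

/-- The arclength is the smallest monotone function dominating the chord lengths. -/
theorem AbsolutelyContinuousCurve.arclenParam_sub_le {γ : ℝ → E} (h : AbsolutelyContinuousCurve γ)
    {S : ℝ → ℝ} (hS : Monotone S) {a b : ℝ}
    (hγS : ∀ u ∈ Icc a b, ∀ v ∈ Icc a b, u ≤ v → ‖γ v - γ u‖ ≤ S v - S u) (hab : a ≤ b) :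
    arclenParam γ b - arclenParam γ a ≤ S b - S a := by
  have hSab := hS.monotoneOn (uIcc a b)
  have hle : ∫ t in a..b, deriv S t ≤ S b - S a := by
    have := hSab.intervalIntegral_deriv_mem_uIcc
    rw [uIcc_of_le (sub_nonneg.2 (hS hab))] at this
    exact this.2
  refine le_trans ?_ hle
  rw [h.arclenParam_sub]
  refine intervalIntegral.integral_mono_ae_restrict hab (h.1 a b).norm
    hSab.intervalIntegrable_deriv ?_
  rw [← restrict_Ioo_eq_restrict_Icc]
  refine (ae_restrict_iff' measurableSet_Ioo).2 ?_
  filter_upwards [hS.ae_differentiableAt] with t ht htab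
  by_cases hd : DifferentiableAt ℝ γ t
  swap
  · rw [deriv_zero_of_not_differentiableAt hd, norm_zero]
    exact hS.deriv_nonneg
  have h2 := ht.hasDerivAt.hasDerivWithinAt (s := Ioi t)
  rw [hasDerivWithinAt_iff_tendsto_slope' self_notMem_Ioi] at h2
  have h1 := hd.hasDerivAt.hasDerivWithinAt (s := Ioi t)
  rw [hasDerivWithinAt_iff_tendsto_slope' self_notMem_Ioi] at h1
  refine le_of_tendsto_of_tendsto h1.norm h2 ?_
  filter_upwards [Ioo_mem_nhdsGT htab.2] with u hu
  have hu0 : 0 < u - t := sub_pos.2 hu.1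
  rw [slope_def_module, slope_def_field, norm_smul, norm_inv, Real.norm_of_nonneg hu0.le,
    div_eq_inv_mul]
  gcongr
  exact hγS t ⟨htab.1.le, htab.2.le⟩ u ⟨htab.1.le.trans hu.1.le, hu.2.le⟩ hu.1.le

theorem exists_ne_of_ae_deriv_pos {γ : ℝ → E} (hreg : ∀ᵐ t : ℝ, 0 < ‖deriv γ t‖) {a b : ℝ}
    (hab : a < b) : ∃ p ∈ Icc a b, ∃ q ∈ Icc a b, 0 < dist (γ p) (γ q) := by
  by_contra! hcon
  have hsub : Icc a b ⊆ {t | γ t = γ a} := fun t ht =>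
    dist_le_zero.1 (hcon t ht a (left_mem_Icc.2 hab.le))
  have := measure_mono_null hsub (volume_levelSet_eq_zero hreg _)
  rw [Real.volume_Icc, ENNReal.ofReal_eq_zero] at this
  linarith

variable [CompleteSpace E]

theorem exists_arclength_parametrization {γ : ℝ → E} (h : AbsolutelyContinuousCurve γ)
    (hper : Function.Periodic γ 1) (hreg : ∀ᵐ t : ℝ, 0 < ‖deriv γ t‖) :
    ∃ Γ : ℝ → E, Continuous Γ ∧ (∀ t, Γ (arclenParam γ t) = γ t) ∧
      (∀ s t, dist (Γ s) (Γ t) ≤ |s - t|) ∧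
      ∀ α, oharaE α 1 γ = arclenEnergy α (curveLen γ 1) Γ := by
  obtain ⟨σ, hσc, -, hσ, hσ'⟩ := exists_continuous_inverse_arclenParam h hper hreg
  refine ⟨γ ∘ σ, h.continuous.comp hσc, fun t => congrArg γ (hσ t), fun s t => ?_, fun α =>
    oharaE_eq_arclenEnergy α h hper hreg hσc hσ⟩
  have := h.norm_sub_le_abs (σ t) (σ s)
  rwa [hσ', hσ', ← dist_eq_norm] at this

/-- Bounded energy and pointwise convergence imply that the arclengths are equicontinuous in the
limit. -/
theorem exists_eventually_arclenParam_sub_lt {α : ℝ} (hα : 2 ≤ α) {M : ℝ≥0∞} (hM : M ≠ ∞)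
    {γ : ℝ → E} {γi : ℕ → ℝ → E} (hc : Continuous γ) (hreg : ∀ᵐ t : ℝ, 0 < ‖deriv γ t‖)
    (hi : ∀ i, AbsolutelyContinuousCurve (γi i)) (hiper : ∀ i, Function.Periodic (γi i) 1)
    (hireg : ∀ i, ∀ᵐ t : ℝ, 0 < ‖deriv (γi i) t‖)
    (hconv : ∀ t, Tendsto (fun i => γi i t) atTop (𝓝 (γ t))) (hE : ∀ i, oharaE α 1 (γi i) ≤ M)
    {ρ : ℝ} (hρ : 0 < ρ) :
    ∃ δ > 0, ∀ u v, 0 ≤ u → v ≤ 1 → u ≤ v → v - u < δ →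
      ∀ᶠ i in atTop, arclenParam (γi i) v - arclenParam (γi i) u < ρ := by
  choose Γ hΓc hΓ hΓlip hΓE using fun i =>
    exists_arclength_parametrization (hi i) (hiper i) (hireg i)
  have hmono (i : ℕ) := (hi i).monotone_arclenParam
  have hfar (a b : ℝ) (hab : a < b) :
      ∃ d > 0, ∀ᶠ i in atTop, d ≤ arclenParam (γi i) b - arclenParam (γi i) a := by
    obtain ⟨p, hp, q, hq, hpq⟩ := exists_ne_of_ae_deriv_pos hreg hab
    refine ⟨dist (γ p) (γ q) / 2, half_pos hpq, ?_⟩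
    filter_upwards [((hconv p).dist (hconv q)).eventually_const_lt (half_lt_self hpq)] with i h
    have h1 := (hi i).norm_sub_le_abs q p
    rw [← dist_eq_norm] at h1
    refine h.le.trans (h1.trans (abs_le.2 ⟨?_, ?_⟩)) <;>
      linarith [hmono i hp.1, hmono i hp.2, hmono i hq.1, hmono i hq.2]
  obtain ⟨d₁, hd₁, hfar₁⟩ := hfar 0 (1 / 2) (by norm_num)
  obtain ⟨d₂, hd₂, hfar₂⟩ := hfar (1 / 2) 1 (by norm_num)
  set ρ' := min (ρ / 2) (min d₁ d₂) with hρ'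
  have hρ1 : ρ' ≤ ρ / 2 := min_le_left _ _
  have hρ2 : ρ' ≤ d₁ := (min_le_right _ _).trans (min_le_left _ _)
  have hρ3 : ρ' ≤ d₂ := (min_le_right _ _).trans (min_le_right _ _)
  obtain ⟨r, hr, hr'⟩ := exists_le_dist_of_arclenEnergy_le (E := E) hα hM
    (show 0 < ρ' by positivity)
  obtain ⟨δ, hδ, hδ'⟩ := Metric.uniformContinuousOn_iff.1
    (isCompact_Icc.uniformContinuousOn_of_continuous (hc.continuousOn (s := Icc 0 1))) r hr
  have hhalf (u v : ℝ) (huv : u ≤ v) (hd : v - u < δ)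
      (h : 0 ≤ u ∧ v ≤ 1 / 2 ∨ 1 / 2 ≤ u ∧ v ≤ 1) :
      ∀ᶠ i in atTop, arclenParam (γi i) v - arclenParam (γi i) u < ρ / 2 := by
    have hu : 0 ≤ u := by rcases h with h | h <;> linarith
    have hv : v ≤ 1 := by rcases h with h | h <;> linarith
    have hdist : dist (γ u) (γ v) < r := by
      refine hδ' u ⟨hu, huv.trans hv⟩ v ⟨hu.trans huv, hv⟩ ?_
      rwa [dist_comm, Real.dist_eq, abs_of_nonneg (sub_nonneg.2 huv)]
    filter_upwards [hfar₁, hfar₂, ((hconv u).dist (hconv v)).eventually_lt_const hdist]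
      with i h1 h2 h3
    by_contra! hcon
    have h0 := arclenParam_zero (γ := γi i)
    have hL := arclenParam_one (γ := γi i)
    refine h3.not_ge ?_
    rw [← hΓ, ← hΓ]
    refine hr' _ (Γ i) (hΓc i) (hΓlip i) ((hΓE i α).symm.trans_le (hE i)) _ _ (h0 ▸ hmono i hu)
      (hL ▸ hmono i hv) (hρ1.trans hcon) ?_
    rcases h with h | h
    · linarith [hmono i h.2, hmono i h.1]
    · linarith [hmono i h.2, hmono i h.1]
  refine ⟨δ, hδ, fun u v hu hv huv hd => ?_⟩
  rcases le_total v (1 / 2) with h1 | h1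
  · exact (hhalf u v huv hd (.inl ⟨hu, h1⟩)).mono fun i h => by linarith
  rcases le_total u (1 / 2) with h2 | h2
  · filter_upwards [hhalf u (1 / 2) h2 (by linarith) (.inl ⟨hu, le_rfl⟩),
      hhalf (1 / 2) v h1 (by linarith) (.inr ⟨le_rfl, hv⟩)] with i h3 h4
    linarith
  · exact (hhalf u v huv hd (.inr ⟨h2, hv⟩)).mono fun i h => by linarith

/-- If the energies are bounded and the arclengths converge, then the limit of the arclengths is
the arclength of the limit, and the energy bound passes to the limit. -/
theorem oharaE_le_of_tendsto_arclenParam {α : ℝ} (hα : 1 ≤ α) {M : ℝ≥0∞} (hM : M ≠ ∞)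
    {γ : ℝ → E} {γi : ℕ → ℝ → E} (h : AbsolutelyContinuousCurve γ) (hper : Function.Periodic γ 1)
    (hreg : ∀ᵐ t : ℝ, 0 < ‖deriv γ t‖)
    (hi : ∀ i, AbsolutelyContinuousCurve (γi i)) (hiper : ∀ i, Function.Periodic (γi i) 1)
    (hireg : ∀ i, ∀ᵐ t : ℝ, 0 < ‖deriv (γi i) t‖)
    (hconv : ∀ t, Tendsto (fun i => γi i t) atTop (𝓝 (γ t))) (hE : ∀ i, oharaE α 1 (γi i) ≤ M)
    {S : ℝ → ℝ} (hS : Monotone S) (hSc : Continuous S)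
    (hlim : ∀ t ∈ Icc (0 : ℝ) 1, Tendsto (fun i => arclenParam (γi i) t) atTop (𝓝 (S t))) :
    oharaE α 1 γ ≤ M := by
  choose Γ hΓc hΓ hΓlip hΓE using fun i =>
    exists_arclength_parametrization (hi i) (hiper i) (hireg i)
  obtain ⟨Γ₀, -, hΓ₀, -, hΓ₀E⟩ := exists_arclength_parametrization h hper hreg
  have hT := h.monotone_arclenParam
  have hT0 := arclenParam_zero (γ := γ)
  have hS0 : S 0 = 0 := tendsto_nhds_unique (hlim 0 (by simp)) (by simp [arclenParam_zero])
  have harc (u v : ℝ) (hu : 0 ≤ u) (hv : v ≤ 1) (huv : u ≤ v) :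
      arclenParam γ v - arclenParam γ u ≤ S v - S u := by
    refine h.arclenParam_sub_le hS (fun u' hu' v' hv' huv' => ?_) huv
    exact le_of_tendsto_of_tendsto' ((hconv v').sub (hconv u')).norm
      ((hlim v' ⟨hu.trans hv'.1, hv'.2.trans hv⟩).sub (hlim u' ⟨hu.trans hu'.1, hu'.2.trans hv⟩))
      fun i => (hi i).norm_sub_le huv'
  set Λ := S 1 with hΛ
  have hΛ0 : 0 < Λ := by
    have h1 := harc 0 1 le_rfl le_rfl zero_le_one
    have h2 := curveLen_pos h hreg
    rw [← arclenParam_one] at h2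
    linarith
  have hclamp (s t : ℝ) (hst : s ≤ t) :
      0 ≤ max 0 (min t Λ) - max 0 (min s Λ) ∧ max 0 (min t Λ) - max 0 (min s Λ) ≤ t - s := by
    grind
  have hex (s : ℝ) : ∃ t ∈ Icc (0 : ℝ) 1, S t = max 0 (min s Λ) := by
    refine intermediate_value_Icc zero_le_one hSc.continuousOn ?_
    rw [hS0]
    exact ⟨le_max_left _ _, max_le hΛ0.le (min_le_right _ _)⟩
  choose τ hτ hSτ using hex
  have hτmono : Monotone τ := fun s t hst => by
    by_contra! hlt
    have h1 := harc _ _ (hτ t).1 (hτ s).2 hlt.le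
    have h2 := h.strictMono_arclenParam hreg hlt
    rw [hSτ, hSτ] at h1
    linarith [(hclamp s t hst).1]
  set A : ℝ → ℝ := fun s => arclenParam γ (τ s) with hAdef
  have hA (s t : ℝ) (hst : s ≤ t) : A t - A s ≤ t - s := by
    have h1 := harc _ _ (hτ s).1 (hτ t).2 (hτmono hst)
    rw [hSτ, hSτ] at h1
    exact h1.trans (hclamp s t hst).2
  have hΓA (s t : ℝ) (hst : s ≤ t) : dist ((γ ∘ τ) s) ((γ ∘ τ) t) ≤ A t - A s := by
    rw [dist_comm, dist_eq_norm]
    exact h.norm_sub_le (hτmono hst)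
  have hcont : Continuous (γ ∘ τ) := by
    refine (LipschitzWith.of_dist_le_mul (K := 1) fun s t => ?_).continuous
    rw [NNReal.coe_one, one_mul, Real.dist_eq]
    rcases le_total s t with hst | hst
    · rw [abs_sub_comm]
      exact ((hΓA s t hst).trans (hA s t hst)).trans (le_abs_self _)
    · rw [dist_comm]
      exact ((hΓA t s hst).trans (hA t s hst)).trans (le_abs_self _)
  have hSτ' : ∀ s ∈ Ioo 0 Λ, S (τ s) = s := fun s hs => by
    rw [hSτ, min_eq_left hs.2.le, max_eq_right hs.1.le]
  have hle : arclenEnergy α Λ (γ ∘ τ) ≤ M := by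
    refine (arclenEnergy_le_liminf (by linarith) (hlim 1 (by simp)) hΓc fun s hs => ?_).trans ?_
    · have h1 : Tendsto (fun i => |s - arclenParam (γi i) (τ s)|) atTop (𝓝 0) := by
        have := ((hlim (τ s) (hτ s)).const_sub s).abs
        rwa [hSτ' s hs, sub_self, abs_zero] at this
      refine (hconv (τ s)).congr_dist (squeeze_zero (fun _ => dist_nonneg) (fun i => ?_) h1)
      rw [← hΓ, dist_comm]
      exact hΓlip i _ _
    · refine liminf_le_of_le ⟨0, by simp⟩ fun b hb => ?_
      obtain ⟨i, hi⟩ := hb.exists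
      exact (hi.trans (hΓE i α).ge).trans (hE i)
  have hAΛ := sub_eq_length_of_arclenEnergy_ne_top hα hΛ0 hcont hA hΓA
    (ne_top_of_le_ne_top hM hle)
  have hA0 : A 0 = 0 := by
    refine le_antisymm ?_ (hT0.symm.trans_le (hT (hτ 0).1))
    have h1 := harc 0 (τ 0) le_rfl (hτ 0).2 (hτ 0).1
    rw [hSτ 0, hT0, hS0, min_eq_left hΛ0.le, max_self] at h1
    linarith
  have hlen : curveLen γ 1 = Λ := by
    rw [← arclenParam_one]
    have h1 := harc (τ Λ) 1 (hτ Λ).1 le_rfl (hτ Λ).2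
    rw [hSτ Λ, min_self, max_eq_right hΛ0.le] at h1
    have h2 := hT (hτ Λ).2
    simp only [hAdef] at hAΛ hA0
    linarith
  rw [hΓ₀E, hlen]
  refine le_of_eq_of_le (setLIntegral_congr_fun (measurableSet_Ioo.prod measurableSet_Ioo) ?_) hle
  have hΓ₀τ : ∀ s ∈ Ioo 0 Λ, Γ₀ s = γ (τ s) := fun s hs => by
    rw [← hΓ₀]
    congr 1
    have h1 := hA 0 s hs.1.le
    have h2 := hA s Λ hs.2.le
    simp only [hAdef] at h1 h2 hAΛ hA0
    linarith
  rintro ⟨s, t⟩ ⟨hs, ht⟩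
  simp only [arclenKernel, Function.comp_apply, hΓ₀τ s hs, hΓ₀τ t ht]

theorem oharaE_le_of_forall_le {α : ℝ} (hα : 2 ≤ α) {M : ℝ≥0∞} (hM : M ≠ ∞)
    {γ : ℝ → E} {γi : ℕ → ℝ → E} (h : AbsolutelyContinuousCurve γ) (hper : Function.Periodic γ 1)
    (hreg : ∀ᵐ t : ℝ, 0 < ‖deriv γ t‖)
    (hi : ∀ i, AbsolutelyContinuousCurve (γi i)) (hiper : ∀ i, Function.Periodic (γi i) 1)
    (hireg : ∀ i, ∀ᵐ t : ℝ, 0 < ‖deriv (γi i) t‖)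
    (hconv : ∀ t, Tendsto (fun i => γi i t) atTop (𝓝 (γ t)))
    (hE : ∀ i, oharaE α 1 (γi i) ≤ M) : oharaE α 1 γ ≤ M := by
  let c (t : ℝ) : ℝ := max 0 (min t 1)
  have hc (u v : ℝ) (huv : u ≤ v) : c u ≤ c v ∧ c v - c u ≤ v - u := by grind
  have hc1 (t : ℝ) : 0 ≤ c t ∧ c t ≤ 1 := by grind
  obtain ⟨φ, hφ, S, hS, hSc, hlim⟩ := exists_subseq_tendsto_of_monotone
    (F := fun i t => arclenParam (γi i) (c t))
    (fun i u v huv => (hi i).monotone_arclenParam (hc u v huv).1)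
    (fun i => by simp [c, arclenParam_zero]) fun ρ hρ => by
      obtain ⟨δ, hδ, hδ'⟩ := exists_eventually_arclenParam_sub_lt hα hM h.continuous hreg hi hiper
        hireg hconv hE hρ
      exact ⟨δ, hδ, fun u v huv hd => hδ' _ _ (hc1 u).1 (hc1 v).2 (hc u v huv).1
        ((hc u v huv).2.trans_lt hd)⟩
  refine oharaE_le_of_tendsto_arclenParam (one_le_two.trans hα) hM h hper hreg
    (fun i => hi (φ i)) (fun i => hiper (φ i)) (fun i => hireg (φ i))
    (fun t => (hconv t).comp hφ.tendsto_atTop) (fun i => hE (φ i)) hS hSc fun t ht => ?_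
  have hct : c t = t := by simp [c, ht.1, ht.2]
  simpa only [hct] using hlim t

end LowerSemicontinuity

/-- lower semicontinuity of O'Hara's energies: for `α ∈ [2,3)` and
`1`-periodic absolutely continuous curves `γ, γᵢ : ℝ → ℝⁿ` with a.e. nonvanishing derivatives
such that `γᵢ → γ` pointwise, one has `E_α(γ) ≤ liminf_i E_α(γᵢ)`. -/
theorem oharaE_lower_semicontinuous
    (α : ℝ) (hα : α ∈ Set.Ico (2:ℝ) 3) (n : ℕ)
    (γ : ℝ → EuclideanSpace ℝ (Fin n)) (γi : ℕ → ℝ → EuclideanSpace ℝ (Fin n))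
    (hγac : AbsolutelyContinuousCurve γ) (hγiac : ∀ i, AbsolutelyContinuousCurve (γi i))
    (hγper : Function.Periodic γ 1) (hγiper : ∀ i, Function.Periodic (γi i) 1)
    (hγreg : ∀ᵐ t : ℝ, 0 < ‖deriv γ t‖)
    (hγireg : ∀ i, ∀ᵐ t : ℝ, 0 < ‖deriv (γi i) t‖)
    (hconv : ∀ t : ℝ, Filter.Tendsto (fun i => γi i t) Filter.atTop (nhds (γ t))) :
    oharaE α 1 γ ≤ Filter.liminf (fun i => oharaE α 1 (γi i)) Filter.atTop := by
  by_contra! hlt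
  obtain ⟨M, hM, hM'⟩ := exists_between hlt
  obtain ⟨φ, hφ, hE⟩ := Filter.extraction_of_frequently_atTop
    (Filter.frequently_lt_of_liminf_lt (by isBoundedDefault) hM)
  exact hM'.not_ge <| oharaE_le_of_forall_le hα.1 hM'.ne_top hγac hγper hγreg
    (fun i => hγiac (φ i)) (fun i => hγiper (φ i)) (fun i => hγireg (φ i))
    (fun t => (hconv t).comp hφ.tendsto_atTop) fun i => (hE i).le
end

section
/- Let m, k, l ∈ ℤ with m ≠ 0, and let γ : ℝ → ℝ³ be a 1-periodic absolutely continuous curve with |γ'| > 0 a.e. and length L := ℒ(γ) ∈ (0,∞), satisfying the symmetry Rot(2πl/m) γ(t + (k/m)·l) = γ(t) for all t ∈ ℝ. Then the arclength parametrization Γ of γ inherits the corresponding symmetry: Rot(2πl/m) Γ(s + (k/m)·l·L) = Γ(s) for all s ∈ ℝ. -/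
open MeasureTheory Real Set
open scoped ENNReal NNReal

/-- Rotation about the `z`-axis by angle `β`, acting on `ℝ³`. -/
noncomputable def rotZ (β : ℝ) (x : EuclideanSpace ℝ (Fin 3)) : EuclideanSpace ℝ (Fin 3) :=
  (WithLp.equiv 2 (Fin 3 → ℝ)).symm
    ![Real.cos β * x 0 - Real.sin β * x 1,
      Real.sin β * x 0 + Real.cos β * x 1,
      x 2]

/-- The rotation `rotZ β` as a linear isometry. -/
noncomputable def rotZIsometry (β : ℝ) :
    EuclideanSpace ℝ (Fin 3) →ₗᵢ[ℝ] EuclideanSpace ℝ (Fin 3) where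
  toFun := rotZ β
  map_add' x y := by
    ext i
    fin_cases i <;> simp [rotZ] <;> ring
  map_smul' c x := by
    ext i
    fin_cases i <;> simp [rotZ] <;> ring
  norm_map' x := by
    simp only [LinearMap.coe_mk, AddHom.coe_mk, EuclideanSpace.norm_eq, Fin.sum_univ_three,
      Real.norm_eq_abs, sq_abs]
    congr 1
    simp [rotZ]
    linear_combination (x 0 ^ 2 + x 1 ^ 2) * Real.sin_sq_add_cos_sq β

theorem LinearIsometryEquiv.norm_deriv_comp {E F : Type*} [NormedAddCommGroup E]
    [NormedSpace ℝ E] [NormedAddCommGroup F] [NormedSpace ℝ F] (e : E ≃ₗᵢ[ℝ] F) (f : ℝ → E)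
    (t : ℝ) : ‖deriv (fun u => e (f u)) t‖ = ‖deriv f t‖ := by
  have h : fderiv ℝ (fun u => e (f u)) t = _ := e.comp_fderiv (f := f) (x := t)
  rw [deriv, h]
  exact e.norm_map _

theorem norm_deriv_periodic_of_rotZ {γ : ℝ → EuclideanSpace ℝ (Fin 3)} {β c : ℝ}
    (hsym : ∀ t, rotZ β (γ (t + c)) = γ t) : Function.Periodic (fun t => ‖deriv γ t‖) c := by
  intro t
  have h := ((rotZIsometry β).toLinearIsometryEquiv rfl).norm_deriv_comp (fun u => γ (u + c)) t
  have h' : (fun u => (rotZIsometry β).toLinearIsometryEquiv rfl (γ (u + c))) = γ :=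
    funext hsym
  rw [h', deriv_comp_add_const] at h
  exact h.symm

/-- The integral over a period `c` commensurable with the period `1`. -/
theorem Function.Periodic.integral_of_commensurable {v : ℝ → ℝ} {c : ℝ} {m n : ℤ} (hm : m ≠ 0)
    (h1 : Function.Periodic v 1) (hc : Function.Periodic v c) (hmn : m * c = n)
    (hint : ∀ a b, IntervalIntegrable v volume a b) :
    ∫ x in (0 : ℝ)..c, v x = c * ∫ x in (0 : ℝ)..1, v x := by
  have ec := hc.intervalIntegral_add_zsmul_eq m 0 hint
  have e1 := h1.intervalIntegral_add_zsmul_eq n 0 hint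
  simp only [zsmul_eq_mul, zero_add, mul_one] at ec e1
  rw [hmn, e1, ← hmn, mul_assoc] at ec
  exact (mul_left_cancel₀ (Int.cast_ne_zero.mpr hm) ec).symm

/-- if a `1`-periodic absolutely continuous curve `γ` with `|γ'| > 0` a.e.
and length `L ∈ (0,∞)` satisfies the symmetry `Rot(2πl/m) γ(t + (k/m)l) = γ(t)` for all `t`,
then its arclength parametrization `Γ` satisfies `Rot(2πl/m) Γ(s + (k/m)l·L) = Γ(s)`
for all `s`. -/
theorem arclength_inherits_symmetry
    (m k l : ℤ) (hm : m ≠ 0)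
    (γ Γ : ℝ → EuclideanSpace ℝ (Fin 3))
    (hγac : AbsolutelyContinuousCurve γ)
    (hγper : Function.Periodic γ 1)
    (hγreg : ∀ᵐ t : ℝ, 0 < ‖deriv γ t‖)
    (L : ℝ) (hL : L = ∫ τ in (0:ℝ)..1, ‖deriv γ τ‖) (hLpos : 0 < L)
    (hsym : ∀ t : ℝ, rotZ (2 * Real.pi * l / m) (γ (t + (k : ℝ) / m * l)) = γ t)
    (hΓper : Function.Periodic Γ L)
    (hΓunit : ∀ᵐ s : ℝ, ‖deriv Γ s‖ = 1)
    (K : NNReal) (hΓlip : LipschitzWith K Γ)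
    (hΓγ : ∀ t : ℝ, Γ (∫ τ in (0:ℝ)..t, ‖deriv γ τ‖) = γ t) :
    ∀ s : ℝ, rotZ (2 * Real.pi * l / m) (Γ (s + (k : ℝ) / m * l * L)) = Γ s := by
  have hc := norm_deriv_periodic_of_rotZ hsym
  have h1 : Function.Periodic (fun t => ‖deriv γ t‖) 1 := fun t => by
    have h := deriv_comp_add_const (f := γ) 1 t
    rw [show (fun u => γ (u + 1)) = γ from funext hγper] at h
    simp only [h]
  have hint : ∀ a b, IntervalIntegrable (fun t => ‖deriv γ t‖) volume a b :=
    fun a b => (hγac.1 a b).norm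
  have hm' : (m : ℝ) ≠ 0 := Int.cast_ne_zero.mpr hm
  have hshift := h1.integral_of_commensurable hm hc (n := k * l)
    (by push_cast; field_simp) hint
  rw [← hL] at hshift
  have hsurj : Function.Surjective (fun t => ∫ τ in (0:ℝ)..t, ‖deriv γ τ‖) :=
    (intervalIntegral.continuous_primitive hint 0).surjective
      (h1.tendsto_atTop_intervalIntegral_of_pos (hL ▸ hLpos) one_pos)
      (h1.tendsto_atBot_intervalIntegral_of_pos (hL ▸ hLpos) one_pos)
  intro s
  obtain ⟨t, rfl⟩ := hsurj s
  have hadd := hc.intervalIntegral_add_eq_add 0 t hint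
  rw [zero_add, hshift] at hadd
  simp only [← hadd, hΓγ, hsym]
end

section
/- Let a, b ∈ ℤ \ {0, ±1} be relatively prime, let m ∈ ℕ with m > 1 divide b, and let k ∈ ℤ satisfy ak + 1 ≡ 0 (mod m). Then for every ρ ∈ (0,1) the torus curve γ_ρ satisfies the symmetry Rot(2πl/m) γ_ρ(t + (k/m)·l) = γ_ρ(t) for every l ∈ ℤ and every t ∈ ℝ. -/
open MeasureTheory Real Set
open scoped ENNReal NNReal

/-- The standard `(a,b)`-torus curve on the torus with radius ratio `ρ`:
`γ_ρ(t) = (cos(2πat)(1+ρcos(2πbt)), sin(2πat)(1+ρcos(2πbt)), ρ sin(2πbt))`. -/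
noncomputable def torusCurve (a b : ℤ) (ρ : ℝ) (t : ℝ) : EuclideanSpace ℝ (Fin 3) :=
  (WithLp.equiv 2 (Fin 3 → ℝ)).symm
    ![Real.cos (2 * Real.pi * a * t) * (1 + ρ * Real.cos (2 * Real.pi * b * t)),
      Real.sin (2 * Real.pi * a * t) * (1 + ρ * Real.cos (2 * Real.pi * b * t)),
      ρ * Real.sin (2 * Real.pi * b * t)]

/-- for coprime `a, b ∈ ℤ \ {0, ±1}`, `m > 1` dividing `b` and `k ∈ ℤ` with
`ak + 1 ≡ 0 (mod m)`, the torus curve `γ_ρ` (for any `ρ ∈ (0,1)`) is symmetric: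
`Rot(2πl/m) γ_ρ(t + (k/m)l) = γ_ρ(t)` for all `l ∈ ℤ` and `t ∈ ℝ`. -/
theorem torusCurve_symmetric
    (a b : ℤ) (ha : a ≠ 0 ∧ a ≠ 1 ∧ a ≠ -1) (hb : b ≠ 0 ∧ b ≠ 1 ∧ b ≠ -1)
    (hab : IsCoprime a b)
    (m : ℕ) (hm : 1 < m) (hmb : (m : ℤ) ∣ b)
    (k : ℤ) (hk : (m : ℤ) ∣ (a * k + 1)) :
    ∀ ρ ∈ Set.Ioo (0:ℝ) 1, ∀ (l : ℤ) (t : ℝ),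
      rotZ (2 * Real.pi * l / m) (torusCurve a b ρ (t + (k : ℝ) / m * l))
        = torusCurve a b ρ t := by
  rintro ρ - l t
  obtain ⟨c, hc⟩ := hk
  obtain ⟨d, rfl⟩ := hmb
  have hm0 : (m : ℝ) ≠ 0 := by positivity
  have hcR : (a : ℝ) * k + 1 = m * c := by exact_mod_cast hc
  have hmeridian : 2 * Real.pi * ((m * d : ℤ) : ℝ) * (t + (k : ℝ) / m * l)
      = 2 * Real.pi * ((m * d : ℤ) : ℝ) * t + ((d * k * l : ℤ) : ℝ) * (2 * Real.pi) := by
    push_cast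
    field_simp
  have hlongitude : 2 * Real.pi * l / m + 2 * Real.pi * a * (t + (k : ℝ) / m * l)
      = 2 * Real.pi * a * t + ((l * c : ℤ) : ℝ) * (2 * Real.pi) := by
    push_cast
    field_simp
    linear_combination (l : ℝ) * hcR
  have hcos := congrArg Real.cos hlongitude
  have hsin := congrArg Real.sin hlongitude
  rw [Real.cos_add_int_mul_two_pi, Real.cos_add] at hcos
  rw [Real.sin_add_int_mul_two_pi, Real.sin_add] at hsin
  unfold rotZ torusCurve
  rw [hmeridian, Real.cos_add_int_mul_two_pi, Real.sin_add_int_mul_two_pi, ← hcos, ← hsin]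
  ext i
  fin_cases i
  · simp
    ring
  · simp
    ring
  · simp
end

section
/- Let μ ∈ (0,1], L > 0, n ∈ ℕ, and let Γ : ℝ → ℝⁿ be an L-periodic continuously differentiable curve with |Γ'(u)| = 1 for all u, whose derivative Γ' is μ-Hölder continuous, and which is injective on [0,L). Then there exists a constant B ≥ 1 (depending on μ and Γ) such that (1/B)|w| ≤ |Γ(u+w) − Γ(u)| ≤ |w| for all u ∈ ℝ and all |w| ≤ L/2. -/
open MeasureTheory Real Set
open scoped ENNReal NNReal

/-- A differentiable curve of unit speed whose derivative is uniformly continuous stretches all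
sufficiently short intervals by a factor of at least `1 / 2`. -/
theorem exists_pos_half_mul_abs_le_norm_sub {E : Type*} [NormedAddCommGroup E] [NormedSpace ℝ E]
    {f : ℝ → E} (hf : Differentiable ℝ f) (hunit : ∀ u, ‖deriv f u‖ = 1)
    (huc : UniformContinuous (deriv f)) :
    ∃ δ > 0, ∀ u w : ℝ, |w| < δ → |w| / 2 ≤ ‖f (u + w) - f u‖ := by
  obtain ⟨δ, hδ, h⟩ := Metric.uniformContinuous_iff.1 huc (1 / 2) (by norm_num)
  refine ⟨δ, hδ, fun u w hw => ?_⟩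
  have key := (convex_ball u δ).norm_image_sub_le_of_norm_hasDerivWithin_le
    (f := fun t => f t - t • deriv f u) (f' := fun t => deriv f t - (1 : ℝ) • deriv f u)
    (C := 1 / 2) (x := u) (y := u + w)
    (fun t _ => ((hf t).hasDerivAt.sub ((hasDerivAt_id t).smul_const _)).hasDerivWithinAt)
    (fun t ht => by
      rw [one_smul, ← dist_eq_norm]
      exact (h (Metric.mem_ball.1 ht)).le)
    (Metric.mem_ball_self hδ) (by simpa [Metric.mem_ball, Real.dist_eq] using hw)
  have hlin : f (u + w) - (u + w) • deriv f u - (f u - u • deriv f u)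
      = (f (u + w) - f u) - w • deriv f u := by
    rw [add_smul]; abel
  simp only [hlin, add_sub_cancel_left, Real.norm_eq_abs] at key
  have hnorm : ‖w • deriv f u‖ = |w| := by rw [norm_smul, hunit, mul_one, Real.norm_eq_abs]
  have htri := norm_sub_norm_le (w • deriv f u) (f (u + w) - f u)
  rw [norm_sub_rev (w • deriv f u), hnorm] at htri
  linarith

/-- A function satisfying a Hölder bound with positive exponent is uniformly continuous. -/
theorem uniformContinuous_of_norm_sub_le_mul_rpow {E : Type*} [NormedAddCommGroup E]
    {g : ℝ → E} {H μ : ℝ} (hH : 0 ≤ H) (hμ : 0 < μ)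
    (hg : ∀ x y : ℝ, ‖g x - g y‖ ≤ H * |x - y| ^ μ) : UniformContinuous g := by
  have hholder : HolderWith H.toNNReal μ.toNNReal g := fun x y => by
    rw [edist_dist, edist_dist, Real.coe_toNNReal μ hμ.le,
      ENNReal.ofReal_rpow_of_nonneg dist_nonneg hμ.le]
    change _ ≤ ENNReal.ofReal H * _
    rw [← ENNReal.ofReal_mul hH, dist_eq_norm, Real.dist_eq]
    exact ENNReal.ofReal_le_ofReal (hg x y)
  exact hholder.uniformContinuous (Real.toNNReal_pos.2 hμ)

/-- A periodic function that is injective on a period takes equal values only at points that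
differ by a multiple of the period. -/
theorem Function.Periodic.exists_sub_eq_zsmul_of_injOn_Ico {α : Type*} {f : ℝ → α} {L : ℝ}
    (hf : Function.Periodic f L) (hL : 0 < L) (hinj : Set.InjOn f (Set.Ico 0 L)) {a b : ℝ}
    (hab : f a = f b) : ∃ k : ℤ, a - b = k • L := by
  obtain ⟨i, hi, -⟩ := existsUnique_sub_zsmul_mem_Ico hL a 0
  obtain ⟨j, hj, -⟩ := existsUnique_sub_zsmul_mem_Ico hL b 0
  rw [zero_add] at hi hj
  have h := hinj hi hj (by rw [hf.sub_zsmul_eq, hf.sub_zsmul_eq, hab])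
  exact ⟨i - j, by rw [sub_smul]; linarith⟩

/-- A continuous periodic curve that is injective on a period has chords bounded away from zero,
as long as the parameter difference stays in a range away from the multiples of the period. -/
theorem exists_pos_le_norm_sub_of_periodic_injOn {E : Type*} [NormedAddCommGroup E]
    {f : ℝ → E} {L δ r : ℝ} (hf : Continuous f) (hper : Function.Periodic f L) (hL : 0 < L)
    (hinj : Set.InjOn f (Set.Ico 0 L)) (hδ : 0 < δ) (hr : r < L) :
    ∃ m > 0, ∀ u w : ℝ, δ ≤ |w| → |w| ≤ r → m ≤ ‖f (u + w) - f u‖ := by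
  have hK : IsCompact (Set.Icc 0 L ×ˢ (Set.Icc (-r) r ∩ {w : ℝ | δ ≤ |w|})) :=
    isCompact_Icc.prod (isCompact_Icc.inter_right (isClosed_le continuous_const continuous_abs))
  obtain ⟨m, hm, hmin⟩ := hK.exists_forall_le' (f := fun p : ℝ × ℝ => ‖f (p.1 + p.2) - f p.1‖)
    (a := 0) (by fun_prop) (by
      rintro ⟨u, w⟩ ⟨-, hw, hδw⟩
      refine norm_pos_iff.2 fun h => ?_
      obtain ⟨k, hk : u + w - u = k • L⟩ :=
        hper.exists_sub_eq_zsmul_of_injOn_Ico hL hinj (sub_eq_zero.1 h)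
      have hwk : |w| = |(k : ℝ)| * L := by
        rw [add_sub_cancel_left, zsmul_eq_mul] at hk
        rw [hk, abs_mul, abs_of_pos hL]
      have hwr : |w| ≤ r := abs_le.2 hw
      have hδw : δ ≤ |w| := hδw
      rcases eq_or_ne k 0 with rfl | hk0
      · simp at hwk
        simp [hwk] at hδw
        linarith
      · have h1 : (1 : ℝ) ≤ |(k : ℝ)| := by exact_mod_cast Int.one_le_abs hk0
        nlinarith)
  refine ⟨m, hm, fun u w hδw hwr => ?_⟩
  obtain ⟨k, hk, -⟩ := existsUnique_sub_zsmul_mem_Ico hL u 0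
  rw [zero_add] at hk
  have h := hmin (u - k • L, w) ⟨Set.Ico_subset_Icc_self hk, abs_le.1 hwr, hδw⟩
  simpa only [sub_add_eq_add_sub, hper.sub_zsmul_eq] using h

/-- an `L`-periodic arclength parametrized curve `Γ : ℝ → ℝⁿ` of class
`C^{1,μ}` (i.e. differentiable with `|Γ'| ≡ 1` and `Γ'` μ-Hölder continuous) which is
injective on `[0,L)` is bi-Lipschitz: there is `B ≥ 1` with
`(1/B)|w| ≤ |Γ(u+w) − Γ(u)| ≤ |w|` for all `u ∈ ℝ` and `|w| ≤ L/2`. -/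
theorem arclength_C1mu_biLipschitz
    (μ L : ℝ) (hμ : μ ∈ Set.Ioc (0:ℝ) 1) (hL : 0 < L) (n : ℕ)
    (Γ : ℝ → EuclideanSpace ℝ (Fin n))
    (hΓper : Function.Periodic Γ L)
    (hΓdiff : Differentiable ℝ Γ)
    (hΓunit : ∀ u : ℝ, ‖deriv Γ u‖ = 1)
    (hΓholder : ∃ H : ℝ, 0 ≤ H ∧ ∀ x y : ℝ, ‖deriv Γ x - deriv Γ y‖ ≤ H * |x - y| ^ μ)
    (hΓinj : Set.InjOn Γ (Set.Ico 0 L)) :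
    ∃ B : ℝ, 1 ≤ B ∧ ∀ u w : ℝ, |w| ≤ L/2 →
      (1/B) * |w| ≤ ‖Γ (u + w) - Γ u‖ ∧ ‖Γ (u + w) - Γ u‖ ≤ |w| := by
  obtain ⟨H, hH, hholder⟩ := hΓholder
  obtain ⟨δ, hδ, hshort⟩ := exists_pos_half_mul_abs_le_norm_sub hΓdiff hΓunit
    (uniformContinuous_of_norm_sub_le_mul_rpow hH hμ.1 hholder)
  obtain ⟨m, hm, hlong⟩ := exists_pos_le_norm_sub_of_periodic_injOn hΓdiff.continuous hΓper hL
    hΓinj hδ (half_lt_self hL)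
  have hB : 0 < max 2 (L / 2 / m) := lt_max_of_lt_left two_pos
  refine ⟨max 2 (L / 2 / m), le_max_of_le_left one_le_two, fun u w hw => ⟨?_, ?_⟩⟩
  · rw [one_div, inv_mul_le_iff₀ hB]
    rcases lt_or_ge |w| δ with hwδ | hwδ
    · calc |w| ≤ 2 * ‖Γ (u + w) - Γ u‖ := by linarith [hshort u w hwδ]
        _ ≤ _ := by gcongr; exact le_max_left _ _
    · calc |w| ≤ L / 2 / m * m := by rwa [div_mul_cancel₀ _ hm.ne']
        _ ≤ _ := by
          gcongr
          · exact le_max_right _ _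
          · exact hlong u w hwδ hw
  · simpa using convex_univ.norm_image_sub_le_of_norm_deriv_le (C := 1) (fun x _ => hΓdiff x)
      (fun x _ => (hΓunit x).le) (Set.mem_univ u) (Set.mem_univ (u + w))
end

section
/- Let a ∈ ℕ with a ≥ 3, and let Γ : ℝ → ℝ³ be a 1-periodic Lipschitz curve, injective on [0,1), with positive length. Suppose v and w are affine lines in ℝ³ such that the rotations Rot(2π/a, v) and Rot(2π/a, w) each map the image Γ(ℝ) onto itself. Then v = w; i.e., such a closed embedded curve cannot have more than one axis of rotational symmetry with rotational angle 2π/a. -/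
open MeasureTheory Real Set
open scoped ENNReal NNReal RealInnerProductSpace

/-- Rotation of `ℝ³` by angle `β` about the line through the origin with (unit) direction `u`,
given by Rodrigues' formula
`x ↦ cos β · x + sin β · (u × x) + (1 − cos β)⟨u, x⟩ u`. -/
noncomputable def rotAxisDir (β : ℝ) (u x : EuclideanSpace ℝ (Fin 3)) :
    EuclideanSpace ℝ (Fin 3) :=
  Real.cos β • x
    + Real.sin β • ((WithLp.equiv 2 (Fin 3 → ℝ)).symm
        (crossProduct (WithLp.equiv 2 (Fin 3 → ℝ) u) (WithLp.equiv 2 (Fin 3 → ℝ) x)))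
    + ((1 - Real.cos β) * ⟪u, x⟫) • u

/-- Rotation `Rot(β, ℓ)` of `ℝ³` by angle `β` about the affine line `ℓ = p + ℝu`
(`u` a unit direction): `x ↦ p + R(x − p)` with `R` the rotation by `β` fixing `u`. -/
noncomputable def rotLine (β : ℝ) (p u : EuclideanSpace ℝ (Fin 3))
    (x : EuclideanSpace ℝ (Fin 3)) : EuclideanSpace ℝ (Fin 3) :=
  p + rotAxisDir β u (x - p)

/-- The action of a `3×3` matrix on `ℝ³` (as a Euclidean space). -/
noncomputable def mulVecE (S : Matrix (Fin 3) (Fin 3) ℝ) (x : EuclideanSpace ℝ (Fin 3)) :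
    EuclideanSpace ℝ (Fin 3) :=
  (WithLp.equiv 2 (Fin 3 → ℝ)).symm (S.mulVec (WithLp.equiv 2 (Fin 3 → ℝ) x))

/-- The affine line `p + ℝu` in `ℝ³`. -/
def affLine (p u : EuclideanSpace ℝ (Fin 3)) : Set (EuclideanSpace ℝ (Fin 3)) :=
  {x | ∃ c : ℝ, x = p + c • u}

theorem rotAxisDir_coord (β : ℝ) (u x : EuclideanSpace ℝ (Fin 3)) :
    rotAxisDir β u x 0 = cos β * x 0 + sin β * (u 1 * x 2 - u 2 * x 1)
        + (1 - cos β) * (u 0 * x 0 + u 1 * x 1 + u 2 * x 2) * u 0 ∧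
    rotAxisDir β u x 1 = cos β * x 1 + sin β * (u 2 * x 0 - u 0 * x 2)
        + (1 - cos β) * (u 0 * x 0 + u 1 * x 1 + u 2 * x 2) * u 1 ∧
    rotAxisDir β u x 2 = cos β * x 2 + sin β * (u 0 * x 1 - u 1 * x 0)
        + (1 - cos β) * (u 0 * x 0 + u 1 * x 1 + u 2 * x 2) * u 2 := by
  refine ⟨?_, ?_, ?_⟩ <;>
    simp [rotAxisDir, cross_apply, PiLp.inner_apply, Fin.sum_univ_three] <;> ring_nf <;> simp

theorem norm_sq_eq_coord (x : EuclideanSpace ℝ (Fin 3)) :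
    ‖x‖ ^ 2 = x 0 ^ 2 + x 1 ^ 2 + x 2 ^ 2 := by
  simp [EuclideanSpace.norm_sq_eq, Fin.sum_univ_three]

theorem inner_eq_coord (x y : EuclideanSpace ℝ (Fin 3)) :
    ⟪x, y⟫ = x 0 * y 0 + x 1 * y 1 + x 2 * y 2 := by
  simp only [PiLp.inner_apply, Fin.sum_univ_three, RCLike.inner_apply, conj_trivial]
  ring

theorem ext_coord {x y : EuclideanSpace ℝ (Fin 3)} (h0 : x 0 = y 0) (h1 : x 1 = y 1)
    (h2 : x 2 = y 2) : x = y := by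
  ext i
  fin_cases i <;> assumption

/-- `rotAxisDir β u` as a linear map. -/
noncomputable def rotLinear (β : ℝ) (u : EuclideanSpace ℝ (Fin 3)) :
    EuclideanSpace ℝ (Fin 3) →ₗ[ℝ] EuclideanSpace ℝ (Fin 3) where
  toFun := rotAxisDir β u
  map_add' x y := by
    apply ext_coord <;> simp only [rotAxisDir_coord, PiLp.add_apply] <;> ring
  map_smul' c x := by
    apply ext_coord <;>
      simp only [rotAxisDir_coord, PiLp.smul_apply, smul_eq_mul, RingHom.id_apply] <;> ring

section Rotation

variable {β : ℝ} {u : EuclideanSpace ℝ (Fin 3)}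

theorem norm_rotAxisDir (hu : ‖u‖ = 1) (x : EuclideanSpace ℝ (Fin 3)) :
    ‖rotAxisDir β u x‖ = ‖x‖ := by
  have hq : u 0 ^ 2 + u 1 ^ 2 + u 2 ^ 2 = 1 := by rw [← norm_sq_eq_coord, hu, one_pow]
  have hcs := Real.sin_sq_add_cos_sq β
  rw [← sq_eq_sq₀ (norm_nonneg _) (norm_nonneg _), norm_sq_eq_coord, norm_sq_eq_coord]
  simp only [rotAxisDir_coord]
  set X := x 0 ^ 2 + x 1 ^ 2 + x 2 ^ 2 with hX
  set d := u 0 * x 0 + u 1 * x 1 + u 2 * x 2 with hd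
  linear_combination (sin β ^ 2 * X + (1 - cos β) ^ 2 * d ^ 2) * hq + (X - d ^ 2) * hcs

theorem rotAxisDir_self (hu : ‖u‖ = 1) : rotAxisDir β u u = u := by
  have hq : u 0 ^ 2 + u 1 ^ 2 + u 2 ^ 2 = 1 := by rw [← norm_sq_eq_coord, hu, one_pow]
  apply ext_coord <;> simp only [rotAxisDir_coord]
  · linear_combination (1 - cos β) * u 0 * hq
  · linear_combination (1 - cos β) * u 1 * hq
  · linear_combination (1 - cos β) * u 2 * hq

theorem inner_rotAxisDir (hu : ‖u‖ = 1) (x : EuclideanSpace ℝ (Fin 3)) :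
    ⟪u, rotAxisDir β u x⟫ = ⟪u, x⟫ := by
  have hq : u 0 ^ 2 + u 1 ^ 2 + u 2 ^ 2 = 1 := by rw [← norm_sq_eq_coord, hu, one_pow]
  simp only [inner_eq_coord, rotAxisDir_coord]
  linear_combination (1 - cos β) * (u 0 * x 0 + u 1 * x 1 + u 2 * x 2) * hq

theorem eq_inner_smul_of_rotAxisDir_rotAxisDir (hu : ‖u‖ = 1) (hs : sin β ≠ 0)
    {x : EuclideanSpace ℝ (Fin 3)} (h : rotAxisDir β u (rotAxisDir β u x) = x) :
    x = ⟪u, x⟫ • u := by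
  have hq : u 0 ^ 2 + u 1 ^ 2 + u 2 ^ 2 = 1 := by rw [← norm_sq_eq_coord, hu, one_pow]
  have hcs := Real.sin_sq_add_cos_sq β
  have hinner : ⟪x, rotAxisDir β u (rotAxisDir β u x)⟫ =
      (cos β ^ 2 - sin β ^ 2) * ‖x‖ ^ 2 + 2 * sin β ^ 2 * ⟪u, x⟫ ^ 2 := by
    simp only [inner_eq_coord, norm_sq_eq_coord, rotAxisDir_coord]
    set d := u 0 * x 0 + u 1 * x 1 + u 2 * x 2 with hd
    set X := x 0 ^ 2 + x 1 ^ 2 + x 2 ^ 2 with hX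
    linear_combination
      (d ^ 2 * (1 - cos β) ^ 2 - sin β ^ 2 * X) * hq - d ^ 2 * hcs
  rw [h, real_inner_self_eq_norm_sq] at hinner
  have hX : ‖x‖ ^ 2 - ⟪u, x⟫ ^ 2 = 0 := by
    have : 2 * sin β ^ 2 * (‖x‖ ^ 2 - ⟪u, x⟫ ^ 2) = 0 := by
      linear_combination hinner + ‖x‖ ^ 2 * hcs
    simpa [hs] using this
  have hz : ‖x - ⟪u, x⟫ • u‖ ^ 2 = 0 := by
    rw [norm_sub_sq_real, norm_smul, real_inner_smul_right, real_inner_comm u x, hu,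
      Real.norm_eq_abs, mul_one, sq_abs]
    linear_combination hX
  exact sub_eq_zero.1 (norm_eq_zero.1 (pow_eq_zero_iff two_ne_zero |>.1 hz))

theorem coord_expansion_of_orthogonal {u₀ u₁ u₂ e₀ e₁ e₂ y₀ y₁ y₂ : ℝ}
    (hq : u₀ ^ 2 + u₁ ^ 2 + u₂ ^ 2 = 1) (hue : u₀ * e₀ + u₁ * e₁ + u₂ * e₂ = 0)
    (huy : u₀ * y₀ + u₁ * y₁ + u₂ * y₂ = 0) :
    (e₀ ^ 2 + e₁ ^ 2 + e₂ ^ 2) * y₀ = (e₀ * y₀ + e₁ * y₁ + e₂ * y₂) * e₀ +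
      ((u₁ * e₂ - u₂ * e₁) * y₀ + (u₂ * e₀ - u₀ * e₂) * y₁ + (u₀ * e₁ - u₁ * e₀) * y₂) *
        (u₁ * e₂ - u₂ * e₁) := by
  linear_combination
    ((e₀ * y₀ + e₁ * y₁ + e₂ * y₂) * e₀ - (e₀ ^ 2 + e₁ ^ 2 + e₂ ^ 2) * y₀) * hq +
    ((u₀ * e₀ + u₁ * e₁ + u₂ * e₂) * y₀ - (e₀ * y₀ + e₁ * y₁ + e₂ * y₂) * u₀ -
      (u₀ * y₀ + u₁ * y₁ + u₂ * y₂) * e₀) * hue + (e₀ ^ 2 + e₁ ^ 2 + e₂ ^ 2) * u₀ * huy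

theorem mem_span_of_inner_eq_zero (hu : ‖u‖ = 1) (hs : sin β ≠ 0)
    {e y : EuclideanSpace ℝ (Fin 3)} (he : e ≠ 0) (hue : ⟪u, e⟫ = 0) (huy : ⟪u, y⟫ = 0) :
    ∃ a b : ℝ, y = a • e + b • rotAxisDir β u e := by
  have hq : u 0 ^ 2 + u 1 ^ 2 + u 2 ^ 2 = 1 := by rw [← norm_sq_eq_coord, hu, one_pow]
  have hE : ‖e‖ ^ 2 ≠ 0 := by simpa using he
  set v : EuclideanSpace ℝ (Fin 3) := (sin β)⁻¹ • (rotAxisDir β u e - cos β • e) with hv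
  rw [inner_eq_coord] at hue huy
  have hv0 : v 0 = u 1 * e 2 - u 2 * e 1 := by
    simp only [hv, PiLp.smul_apply, PiLp.sub_apply, smul_eq_mul, rotAxisDir_coord, hue]
    field_simp; ring
  have hv1 : v 1 = u 2 * e 0 - u 0 * e 2 := by
    simp only [hv, PiLp.smul_apply, PiLp.sub_apply, smul_eq_mul, rotAxisDir_coord, hue]
    field_simp; ring
  have hv2 : v 2 = u 0 * e 1 - u 1 * e 0 := by
    simp only [hv, PiLp.smul_apply, PiLp.sub_apply, smul_eq_mul, rotAxisDir_coord, hue]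
    field_simp; ring
  have key : ‖e‖ ^ 2 • y = ⟪e, y⟫ • e + ⟪v, y⟫ • v := by
    apply ext_coord <;>
      simp only [PiLp.smul_apply, PiLp.add_apply, smul_eq_mul, norm_sq_eq_coord, inner_eq_coord,
        hv0, hv1, hv2]
    · exact coord_expansion_of_orthogonal hq hue huy
    · linear_combination coord_expansion_of_orthogonal (u₀ := u 1) (u₁ := u 2) (u₂ := u 0)
        (e₀ := e 1) (e₁ := e 2) (e₂ := e 0) (y₀ := y 1) (y₁ := y 2) (y₂ := y 0)
        (by linear_combination hq) (by linear_combination hue) (by linear_combination huy)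
    · linear_combination coord_expansion_of_orthogonal (u₀ := u 2) (u₁ := u 0) (u₂ := u 1)
        (e₀ := e 2) (e₁ := e 0) (e₂ := e 1) (y₀ := y 2) (y₁ := y 0) (y₂ := y 1)
        (by linear_combination hq) (by linear_combination hue) (by linear_combination huy)
  refine ⟨(‖e‖ ^ 2)⁻¹ * (⟪e, y⟫ - ⟪v, y⟫ * (sin β)⁻¹ * cos β),
    (‖e‖ ^ 2)⁻¹ * (⟪v, y⟫ * (sin β)⁻¹), ?_⟩
  have hy : y = (‖e‖ ^ 2)⁻¹ • (⟪e, y⟫ • e + ⟪v, y⟫ • v) := by rw [← key, inv_smul_smul₀ hE]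
  generalize ⟪e, y⟫ = k at hy ⊢
  generalize ⟪v, y⟫ = m at hy ⊢
  rw [hy, hv]
  module

theorem rotAxisDir_sub (x y : EuclideanSpace ℝ (Fin 3)) :
    rotAxisDir β u (x - y) = rotAxisDir β u x - rotAxisDir β u y :=
  (rotLinear β u).map_sub x y

theorem isometry_rotLine (hu : ‖u‖ = 1) (p : EuclideanSpace ℝ (Fin 3)) :
    Isometry (rotLine β p u) := by
  refine Isometry.of_dist_eq fun x y => ?_
  rw [rotLine, rotLine, dist_add_left, dist_eq_norm, ← rotAxisDir_sub, norm_rotAxisDir hu,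
    sub_sub_sub_cancel_right, dist_eq_norm]

theorem surjective_rotLine (hu : ‖u‖ = 1) (p : EuclideanSpace ℝ (Fin 3)) :
    Function.Surjective (rotLine β p u) := by
  have hinj : Function.Injective (rotLinear β u) := by
    rw [injective_iff_map_eq_zero]
    intro x hx
    rw [← norm_eq_zero, ← norm_rotAxisDir (β := β) hu x]
    exact norm_eq_zero.2 hx
  intro y
  obtain ⟨x, hx⟩ := (LinearMap.injective_iff_surjective.1 hinj) (y - p)
  refine ⟨x + p, ?_⟩
  change p + rotLinear β u (x + p - p) = y
  rw [add_sub_cancel_right, hx, add_sub_cancel]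

/-- `rotLine β p u` as an isometry of `ℝ³`. -/
noncomputable def rotLineEquiv (β : ℝ) (p : EuclideanSpace ℝ (Fin 3)) (hu : ‖u‖ = 1) :
    EuclideanSpace ℝ (Fin 3) ≃ᵢ EuclideanSpace ℝ (Fin 3) where
  toEquiv := Equiv.ofBijective (rotLine β p u)
    ⟨(isometry_rotLine hu p).injective, surjective_rotLine hu p⟩
  isometry_toFun := isometry_rotLine hu p

theorem mem_affLine_of_rotLine_rotLine (hu : ‖u‖ = 1) (hs : sin β ≠ 0)
    {p x : EuclideanSpace ℝ (Fin 3)} (h : rotLine β p u (rotLine β p u x) = x) :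
    x ∈ affLine p u := by
  refine ⟨⟪u, x - p⟫, ?_⟩
  rw [← eq_inner_smul_of_rotAxisDir_rotAxisDir (x := x - p) hu hs, add_sub_cancel]
  rw [rotLine, rotLine, add_sub_cancel_left] at h
  rw [eq_sub_iff_add_eq', h]

theorem affLine_eq_of_rotLine_commute {p₁ u₁ p₂ u₂ : EuclideanSpace ℝ (Fin 3)}
    (hu₁ : ‖u₁‖ = 1) (hu₂ : ‖u₂‖ = 1) (hs : sin β ≠ 0) {S : Set (EuclideanSpace ℝ (Fin 3))}
    (hS₁ : MapsTo (rotLine β p₁ u₁) S S) (hS₂ : MapsTo (rotLine β p₂ u₂) S S)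
    (h₁ : ¬ S ⊆ affLine p₁ u₁) (h₂ : ¬ S ⊆ affLine p₂ u₂)
    (hcomm : ∀ x ∈ S, rotLine β p₁ u₁ (rotLine β p₂ u₂ x) = rotLine β p₂ u₂ (rotLine β p₁ u₁ x)) :
    affLine p₁ u₁ = affLine p₂ u₂ := by
  set M := rotLinear β u₁ ∘ₗ rotLinear β u₂ - rotLinear β u₂ ∘ₗ rotLinear β u₁ with hM
  have hM_apply : ∀ x, M x = rotAxisDir β u₁ (rotAxisDir β u₂ x) -
      rotAxisDir β u₂ (rotAxisDir β u₁ x) := fun x => rfl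
  have hMsub : ∀ x y, rotLine β p₁ u₁ (rotLine β p₂ u₂ x) - rotLine β p₂ u₂ (rotLine β p₁ u₁ x)
      - (rotLine β p₁ u₁ (rotLine β p₂ u₂ y) - rotLine β p₂ u₂ (rotLine β p₁ u₁ y))
      = M (x - y) := by
    intro x y
    change (p₁ + rotLinear β u₁ (p₂ + rotLinear β u₂ (x - p₂) - p₁))
      - (p₂ + rotLinear β u₂ (p₁ + rotLinear β u₁ (x - p₁) - p₂))
      - ((p₁ + rotLinear β u₁ (p₂ + rotLinear β u₂ (y - p₂) - p₁))
      - (p₂ + rotLinear β u₂ (p₁ + rotLinear β u₁ (y - p₁) - p₂))) = _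
    simp only [hM, LinearMap.sub_apply, LinearMap.comp_apply, map_add, map_sub]
    abel
  have hMS : ∀ x ∈ S, ∀ y ∈ S, M (x - y) = 0 := by
    intro x hx y hy
    rw [← hMsub, hcomm x hx, hcomm y hy, sub_self, sub_self, sub_self]
  have hperp : ∀ p u : EuclideanSpace ℝ (Fin 3), ‖u‖ = 1 → MapsTo (rotLine β p u) S S →
      ¬ S ⊆ affLine p u → ∀ y, ⟪u, y⟫ = 0 → M y = 0 := by
    intro p u hu hS hSl y hy
    obtain ⟨x, hxS, hx⟩ := not_subset.1 hSl
    set e := rotLine β p u x - x with he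
    have he0 : e ≠ 0 := by
      intro h0
      have hfix := sub_eq_zero.1 h0
      exact hx (mem_affLine_of_rotLine_rotLine hu hs (by rw [hfix, hfix]))
    have hue : ⟪u, e⟫ = 0 := by
      rw [he, rotLine, inner_sub_right, inner_add_right, inner_rotAxisDir hu, inner_sub_right]
      ring
    have hRe : rotAxisDir β u e = rotLine β p u (rotLine β p u x) - rotLine β p u x := by
      rw [he, rotLine, rotLine, add_sub_add_left_eq_sub, ← rotAxisDir_sub,
        sub_sub_sub_cancel_right]
    obtain ⟨a, b, rfl⟩ := mem_span_of_inner_eq_zero hu hs he0 hue hy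
    rw [map_add, map_smul, map_smul, hRe, he, hMS _ (hS hxS) _ hxS, hMS _ (hS (hS hxS)) _ (hS hxS),
      smul_zero, smul_zero, add_zero]
  have hM₁ := hperp p₁ u₁ hu₁ hS₁ h₁
  have hM₂ := hperp p₂ u₂ hu₂ hS₂ h₂
  have hu₁₁ : ⟪u₁, u₁⟫ = 1 := by rw [real_inner_self_eq_norm_sq, hu₁, one_pow]
  have hu₂₂ : ⟪u₂, u₂⟫ = 1 := by rw [real_inner_self_eq_norm_sq, hu₂, one_pow]
  have hM_zero_of : M u₁ = 0 → ∀ z, M z = 0 := by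
    intro h z
    have hz : M (z - ⟪u₁, z⟫ • u₁) = 0 :=
      hM₁ _ (by rw [inner_sub_right, real_inner_smul_right, hu₁₁, mul_one, sub_self])
    rwa [map_sub, map_smul, h, smul_zero, sub_zero] at hz
  have hpar : u₁ = ⟪u₂, u₁⟫ • u₂ := by
    by_contra hne
    set w := u₁ - ⟪u₂, u₁⟫ • u₂ with hw
    have hw0 : w ≠ 0 := sub_ne_zero.2 hne
    have hw₂ : ⟪u₂, w⟫ = 0 := by
      rw [hw, inner_sub_right, real_inner_smul_right, hu₂₂, mul_one, sub_self]
    have hw₁ : ⟪u₁, w⟫ = ‖w‖ ^ 2 := by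
      have : u₁ = w + ⟪u₂, u₁⟫ • u₂ := by rw [hw, sub_add_cancel]
      nth_rewrite 1 [this]
      rw [inner_add_left, real_inner_smul_left, hw₂, mul_zero, add_zero,
        real_inner_self_eq_norm_sq]
    have hwn : ‖w‖ ^ 2 ≠ 0 := by simpa using hw0
    have hMu : M u₁ = 0 := by
      have h := hM₁ (u₁ - (‖w‖ ^ 2)⁻¹ • w) (by
        rw [inner_sub_right, real_inner_smul_right, hw₁, hu₁₁, inv_mul_cancel₀ hwn, sub_self])
      rwa [map_sub, map_smul, hM₂ w hw₂, smul_zero, sub_zero] at h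
    set v := rotAxisDir β u₂ u₁ with hv
    have hfix : rotAxisDir β u₁ v = v := by
      rw [hM_apply, rotAxisDir_self hu₁] at hMu
      exact sub_eq_zero.1 hMu
    have hvu : v = ⟪u₁, v⟫ • u₁ :=
      eq_inner_smul_of_rotAxisDir_rotAxisDir hu₁ hs (by rw [hfix, hfix])
    have hk : ⟪u₁, v⟫ * ⟪u₁, v⟫ = 1 := by
      have hn : ‖v‖ = 1 := by rw [hv, norm_rotAxisDir hu₂, hu₁]
      rw [hvu, norm_smul, hu₁, mul_one, Real.norm_eq_abs] at hn
      rw [← abs_mul_abs_self, hn, one_mul]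
    refine hne (eq_inner_smul_of_rotAxisDir_rotAxisDir hu₂ hs ?_)
    rw [← hv]
    nth_rewrite 1 [hvu]
    change rotLinear β u₂ (⟪u₁, v⟫ • u₁) = u₁
    rw [map_smul]
    change ⟪u₁, v⟫ • v = u₁
    nth_rewrite 2 [hvu]
    rw [smul_smul, hk, one_smul]
  have hMz : ∀ z, M z = 0 := by
    apply hM_zero_of
    have h : rotAxisDir β u₂ u₁ = u₁ := by
      rw [hpar]
      change rotLinear β u₂ (_ • u₂) = _
      rw [map_smul]
      exact congrArg _ (rotAxisDir_self hu₂)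
    rw [hM_apply, h, rotAxisDir_self hu₁, h, sub_self]
  obtain ⟨x, hxS, -⟩ := not_subset.1 h₁
  have hp₂ : rotLine β p₂ u₂ p₂ = p₂ := by
    rw [rotLine, sub_self]
    change p₂ + rotLinear β u₂ 0 = p₂
    rw [map_zero, add_zero]
  have hfix : rotLine β p₂ u₂ (rotLine β p₁ u₁ p₂) = rotLine β p₁ u₁ p₂ := by
    have h := hMsub p₂ x
    rw [hcomm x hxS, sub_self, sub_zero, hMz, hp₂, sub_eq_zero] at h
    exact h.symm
  set ε := ⟪u₂, u₁⟫ with hε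
  have hε2 : ε * ε = 1 := by
    have hn := hu₁
    rw [hpar, norm_smul, hu₂, mul_one, Real.norm_eq_abs] at hn
    rw [← abs_mul_abs_self, hn, one_mul]
  obtain ⟨c, hc⟩ := mem_affLine_of_rotLine_rotLine hu₂ hs (x := rotLine β p₁ u₁ p₂) (p := p₂)
    (by rw [hfix, hfix])
  have hc0 : c = 0 := by
    have h : ⟪u₁, rotLine β p₁ u₁ p₂ - p₂⟫ = 0 := by
      rw [rotLine, inner_sub_right, inner_add_right, inner_rotAxisDir hu₁, inner_sub_right]
      ring
    rw [hc, add_sub_cancel_left, real_inner_smul_right, real_inner_comm, ← hε] at h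
    rcases mul_eq_zero.1 h with h | h
    · exact h
    · simp [h] at hε2
  rw [hc0, zero_smul, add_zero] at hc
  obtain ⟨d, hd⟩ := mem_affLine_of_rotLine_rotLine hu₁ hs (x := p₂) (p := p₁) (by rw [hc, hc])
  have hu₂ε : u₂ = ε • u₁ := by rw [hpar, smul_smul, hε2, one_smul]
  ext z
  constructor
  · rintro ⟨k, rfl⟩
    refine ⟨(k - d) * ε, ?_⟩
    rw [hd, mul_smul, ← hpar]
    module
  · rintro ⟨k, rfl⟩
    refine ⟨d + k * ε, ?_⟩
    rw [hd, hu₂ε]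
    module

end Rotation

theorem AddCircle.eq_or_eq_neg_of_norm_eq {L : ℝ} {a b : AddCircle L} (h : ‖a‖ = ‖b‖) :
    a = b ∨ a = -b := by
  have hrep : ∀ c : AddCircle L, ∃ x : ℝ, (x : AddCircle L) = c ∧ ‖c‖ = |x| := by
    intro c
    induction c using QuotientAddGroup.induction_on with
    | H x =>
      refine ⟨x - round (L⁻¹ * x) * L, ?_, AddCircle.norm_eq L⟩
      rw [AddCircle.coe_sub, sub_eq_self, AddCircle.coe_eq_zero_iff]
      exact ⟨round (L⁻¹ * x), zsmul_eq_mul _ _⟩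
  obtain ⟨x, rfl, hx⟩ := hrep a
  obtain ⟨y, rfl, hy⟩ := hrep b
  rw [hx, hy, abs_eq_abs] at h
  rcases h with rfl | rfl
  · exact Or.inl rfl
  · exact Or.inr (AddCircle.coe_neg ..)

theorem AddCircle.norm_coe_of_mem_Icc {L s : ℝ} (hL : 0 < L) (hs : s ∈ Icc 0 L) :
    ‖(s : AddCircle L)‖ = min s (L - s) := by
  rcases le_total s (L / 2) with h | h
  · rw [(AddCircle.norm_coe_eq_abs_iff L hL.ne').2 (by
      rwa [abs_of_nonneg hs.1, abs_of_pos hL]), abs_of_nonneg hs.1, min_eq_left (by linarith)]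
  · have h1 : ((s - L : ℝ) : AddCircle L) = s := by
      rw [AddCircle.coe_sub, AddCircle.coe_period, sub_zero]
    have h2 : |s - L| = L - s := by rw [abs_sub_comm, abs_of_nonneg (by linarith [hs.2])]
    rw [← h1, (AddCircle.norm_coe_eq_abs_iff L hL.ne').2 (by
      rw [h2, abs_of_pos hL]; linarith), h2, min_eq_right (by linarith)]

/-- A map preserving the circle distance of an injective coordinate is a rotation or a
reflection in that coordinate. -/
theorem exists_rotation_or_reflection {X : Type*} {S : Set X} {L : ℝ} {φ : X → AddCircle L}
    (hS : S.Nonempty) {e : X → X}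
    (h : ∀ x ∈ S, ∀ y ∈ S, ‖φ (e x) - φ (e y)‖ = ‖φ x - φ y‖) :
    ∃ c, (∀ x ∈ S, φ (e x) = φ x + c) ∨ ∀ x ∈ S, φ (e x) = -φ x + c := by
  obtain ⟨o, ho⟩ := hS
  have hsign : ∀ x ∈ S, φ (e x) - φ (e o) = φ x - φ o ∨ φ (e x) - φ (e o) = -(φ x - φ o) :=
    fun x hx => AddCircle.eq_or_eq_neg_of_norm_eq (h x hx o ho)
  by_cases hrot : ∀ x ∈ S, φ (e x) - φ (e o) = φ x - φ o
  · refine ⟨φ (e o) - φ o, Or.inl fun x hx => ?_⟩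
    rw [eq_add_of_sub_eq (hrot x hx)]
    abel
  · by_cases hrefl : ∀ x ∈ S, φ (e x) - φ (e o) = -(φ x - φ o)
    · refine ⟨φ (e o) + φ o, Or.inr fun x hx => ?_⟩
      rw [eq_add_of_sub_eq (hrefl x hx)]
      abel
    · push Not at hrot hrefl
      obtain ⟨y, hy, hyne⟩ := hrot
      obtain ⟨x, hx, hxne⟩ := hrefl
      have hx' := (hsign x hx).resolve_right hxne
      have hy' := (hsign y hy).resolve_left hyne
      exfalso
      rcases AddCircle.eq_or_eq_neg_of_norm_eq (h x hx y hy) with hxy | hxy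
      · apply hyne
        calc φ (e y) - φ (e o) = (φ (e x) - φ (e o)) - (φ (e x) - φ (e y)) := by abel
          _ = φ y - φ o := by rw [hx', hxy]; abel
      · apply hxne
        calc φ (e x) - φ (e o) = (φ (e x) - φ (e y)) + (φ (e y) - φ (e o)) := by abel
          _ = -(φ x - φ o) := by rw [hxy, hy']; abel

section ClosedCurve

variable {X : Type*} {Γ : ℝ → X}

theorem apply_fract_of_periodic (hper : Function.Periodic Γ 1) (t : ℝ) :
    Γ (Int.fract t) = Γ t := by
  simpa using hper.sub_int_mul_eq (x := t) ⌊t⌋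

theorem exists_int_of_eq (hper : Function.Periodic Γ 1) (hinj : InjOn Γ (Ico 0 1))
    {s t : ℝ} (h : Γ s = Γ t) : ∃ n : ℤ, s = t + n := by
  have hst : Int.fract s = Int.fract t :=
    hinj ⟨Int.fract_nonneg s, Int.fract_lt_one s⟩ ⟨Int.fract_nonneg t, Int.fract_lt_one t⟩
      (by rw [apply_fract_of_periodic hper, apply_fract_of_periodic hper, h])
  obtain ⟨n, hn⟩ := Int.fract_eq_fract.1 hst
  exact ⟨n, by linarith⟩

theorem eq_or_eq_add_one_of_eq (hper : Function.Periodic Γ 1) (hinj : InjOn Γ (Ico 0 1))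
    {s t : ℝ} (h : Γ s = Γ t) (hst : s ≤ t) (hts : t ≤ s + 1) : t = s ∨ t = s + 1 := by
  obtain ⟨n, hn⟩ := exists_int_of_eq hper hinj h.symm
  have h0 : (-1 : ℝ) < n := by linarith
  have h1 : (n : ℝ) < 2 := by linarith
  have h0' : -1 < n := by exact_mod_cast h0
  have h1' : n < 2 := by exact_mod_cast h1
  obtain rfl | rfl : n = 0 ∨ n = 1 := by omega
  · left; simpa using hn
  · right; simpa using hn

theorem image_Icc_inter_subset (hper : Function.Periodic Γ 1) (hinj : InjOn Γ (Ico 0 1))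
    {r s t : ℝ} (htr : t ≤ r + 1) :
    Γ '' Icc r s ∩ Γ '' Icc s t ⊆ {Γ r, Γ s} := by
  rintro _ ⟨⟨a, ha, rfl⟩, b, hb, hab⟩
  rcases eq_or_eq_add_one_of_eq hper hinj hab.symm (ha.2.trans hb.1)
    (by linarith [ha.1, hb.2]) with h | h
  · right; rw [mem_singleton_iff, le_antisymm ha.2 (h ▸ hb.1)]
  · left; rw [show a = r by linarith [ha.1, hb.2]]

theorem range_eq_image_Icc (hper : Function.Periodic Γ 1) (s : ℝ) :
    range Γ = Γ '' Icc s (s + 1) := (hper.image_Icc one_pos s).symm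

variable [MetricSpace X]

/-- A connected subset of a closed curve containing the two points `Γ s` and `Γ t` contains one of
the two open arcs between them. -/
theorem arc_subset_of_isPreconnected (hc : Continuous Γ) (hper : Function.Periodic Γ 1)
    (hinj : InjOn Γ (Ico 0 1)) {C : Set X} (hC : IsPreconnected C) (hCS : C ⊆ range Γ)
    {s t : ℝ} (hsC : Γ s ∈ C) (htC : Γ t ∈ C) :
    Γ '' Ioo s t ⊆ C ∨ Γ '' Ioo t (s + 1) ⊆ C := by
  by_contra! hcon
  obtain ⟨_, ⟨⟨p, hp, rfl⟩, hpC⟩⟩ := not_subset.1 hcon.1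
  obtain ⟨_, ⟨⟨q, hq, rfl⟩, hqC⟩⟩ := not_subset.1 hcon.2
  have hclosed : ∀ a b, IsClosed (Γ '' Icc a b) := fun a b => (isCompact_Icc.image hc).isClosed
  have hcover : C ⊆ Γ '' Icc p q ∪ Γ '' Icc q (p + 1) := by
    rw [← image_union, Icc_union_Icc_eq_Icc (by linarith [hp.2, hq.1]) (by linarith [hp.1, hq.2]),
      ← range_eq_image_Icc hper]
    exact hCS
  obtain ⟨x, hxC, hx⟩ := isPreconnected_closed_iff.1 hC _ _ (hclosed p q) (hclosed q (p + 1)) hcover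
    ⟨Γ t, htC, t, ⟨hp.2.le, hq.1.le⟩, rfl⟩
    ⟨Γ s, hsC, s + 1, ⟨hq.2.le, by linarith [hp.1]⟩, hper s⟩
  rcases image_Icc_inter_subset hper hinj le_rfl hx with rfl | rfl
  · exact hpC hxC
  · exact hqC hxC

variable [MeasurableSpace X] [BorelSpace X]

open Measure

theorem ofReal_dist_le_hausdorffMeasure {C : Set X} (hC : IsPreconnected C) {x y : X}
    (hx : x ∈ C) (hy : y ∈ C) : ENNReal.ofReal (dist x y) ≤ μH[1] C := by
  have hsub : Icc 0 (dist x y) ⊆ (fun z => dist x z) '' C := by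
    have h := (hC.image (fun z => dist x z) (by fun_prop)).ordConnected.out
      (mem_image_of_mem _ hx) (mem_image_of_mem _ hy)
    simpa using h
  calc ENNReal.ofReal (dist x y) = μH[1] (Icc 0 (dist x y)) := by
        rw [hausdorffMeasure_real, Real.volume_Icc, sub_zero]
    _ ≤ μH[1] ((fun z => dist x z) '' C) := measure_mono hsub
    _ ≤ ((1 : ℝ≥0) : ℝ≥0∞) ^ (1 : ℝ) * μH[1] C :=
        (LipschitzWith.dist_right x).hausdorffMeasure_image_le zero_le_one C
    _ = μH[1] C := by simp

theorem hausdorffMeasure_image_Icc_ne_top {K : ℝ≥0} (hΓ : LipschitzWith K Γ) (s t : ℝ) :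
    μH[1] (Γ '' Icc s t) ≠ ∞ := by
  refine ne_top_of_le_ne_top ?_ (hΓ.hausdorffMeasure_image_le zero_le_one _)
  rw [hausdorffMeasure_real, Real.volume_Icc, ENNReal.rpow_one]
  exact ENNReal.mul_ne_top ENNReal.coe_ne_top ENNReal.ofReal_ne_top

theorem hausdorffMeasure_image_Icc_add (hc : Continuous Γ) (hper : Function.Periodic Γ 1)
    (hinj : InjOn Γ (Ico 0 1)) {r s t : ℝ} (hrs : r ≤ s) (hst : s ≤ t) (htr : t ≤ r + 1) :
    μH[1] (Γ '' Icc r t) = μH[1] (Γ '' Icc r s) + μH[1] (Γ '' Icc s t) := by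
  have := nullSingletonClass_hausdorff X one_pos
  rw [← Icc_union_Icc_eq_Icc hrs hst, image_union]
  refine measure_union₀ (isCompact_Icc.image hc).isClosed.measurableSet.nullMeasurableSet ?_
  exact measure_mono_null (image_Icc_inter_subset hper hinj htr) ((Set.toFinite _).measure_zero _)

theorem hausdorffMeasure_image_Icc_le {C : Set X} {s t : ℝ} (h : Γ '' Ioo s t ⊆ C) :
    μH[1] (Γ '' Icc s t) ≤ μH[1] C := by
  have := nullSingletonClass_hausdorff X one_pos
  have hsub : Γ '' Icc s t ⊆ C ∪ {Γ s, Γ t} := by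
    rintro _ ⟨r, hr, rfl⟩
    rcases eq_or_lt_of_le hr.1 with rfl | h1
    · right; left; rfl
    rcases eq_or_lt_of_le hr.2 with rfl | h2
    · right; right; rfl
    exact Or.inl (h ⟨r, ⟨h1, h2⟩, rfl⟩)
  calc μH[1] (Γ '' Icc s t) ≤ μH[1] (C ∪ {Γ s, Γ t}) := measure_mono hsub
    _ ≤ μH[1] C + μH[1] {Γ s, Γ t} := measure_union_le _ _
    _ = μH[1] C := by rw [(Set.toFinite {Γ s, Γ t}).measure_zero, add_zero]

/-- The arc-length coordinate of a rectifiable closed embedded curve: distances in the circle are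
the smallest lengths of connected subsets of the curve joining two points. -/
theorem exists_arcLength_coordinate {K : ℝ≥0} (hΓ : LipschitzWith K Γ)
    (hper : Function.Periodic Γ 1) (hinj : InjOn Γ (Ico 0 1)) :
    ∃ (L : ℝ) (φ : X → AddCircle L), ∀ x ∈ range Γ, ∀ y ∈ range Γ,
      (∃ C ⊆ range Γ, IsPreconnected C ∧ x ∈ C ∧ y ∈ C ∧ μH[1] C = ENNReal.ofReal ‖φ x - φ y‖) ∧
      ∀ C ⊆ range Γ, IsPreconnected C → x ∈ C → y ∈ C → ENNReal.ofReal ‖φ x - φ y‖ ≤ μH[1] C := by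
  have hc := hΓ.continuous
  set m : ℝ → ℝ → ℝ := fun s t => (μH[1] (Γ '' Icc s t)).toReal with hm
  have hm_nonneg : ∀ s t, 0 ≤ m s t := fun s t => ENNReal.toReal_nonneg
  have hm_add : ∀ r s t, r ≤ s → s ≤ t → t ≤ r + 1 → m r t = m r s + m s t := by
    intro r s t hrs hst htr
    rw [hm]
    dsimp only
    rw [hausdorffMeasure_image_Icc_add hc hper hinj hrs hst htr, ENNReal.toReal_add
      (hausdorffMeasure_image_Icc_ne_top hΓ r s) (hausdorffMeasure_image_Icc_ne_top hΓ s t)]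
  have hm_ofReal : ∀ s t, μH[1] (Γ '' Icc s t) = ENNReal.ofReal (m s t) := fun s t =>
    (ENNReal.ofReal_toReal (hausdorffMeasure_image_Icc_ne_top hΓ s t)).symm
  have hm_shift : ∀ s, m 1 (s + 1) = m 0 s := by
    intro s
    have h : Γ '' Icc 1 (s + 1) = Γ '' Icc 0 s := by
      have h1 := image_add_const_Icc (1 : ℝ) 0 s
      rw [zero_add] at h1
      rw [← h1, image_image]
      exact image_congr fun x _ => hper x
    simp only [hm, h]
  set L := m 0 1 with hL
  have hLpos : 0 < L := by
    have hne : Γ 0 ≠ Γ (1 / 2) := fun h => by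
      have := hinj ⟨le_rfl, one_pos⟩ ⟨by norm_num, by norm_num⟩ h
      norm_num at this
    have h := ofReal_dist_le_hausdorffMeasure (isPreconnected_Icc.image Γ hc.continuousOn)
      (mem_image_of_mem Γ (left_mem_Icc.2 zero_le_one))
      (mem_image_of_mem Γ (show (1 / 2 : ℝ) ∈ Icc (0 : ℝ) 1 by constructor <;> norm_num))
    rw [hm_ofReal, ENNReal.ofReal_le_ofReal_iff (hm_nonneg 0 1)] at h
    exact (dist_pos.2 hne).trans_le h
  set φ : X → AddCircle L := fun x => (m 0 (Function.invFunOn Γ (Ico 0 1) x) : ℝ) with hφ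
  have hφΓ : ∀ t ∈ Ico (0 : ℝ) 1, φ (Γ t) = (m 0 t : ℝ) := fun t ht => by
    simp only [hφ, hinj.leftInvOn_invFunOn ht]
  have hnorm : ∀ s ∈ Ico (0 : ℝ) 1, ∀ t ∈ Ico (0 : ℝ) 1, s ≤ t →
      ‖φ (Γ s) - φ (Γ t)‖ = min (m s t) (m t (s + 1)) := by
    intro s hs t ht hst
    have h1 := hm_add 0 s t hs.1 hst (by linarith [ht.2])
    have h2 := hm_add 0 t 1 ht.1 ht.2.le (by norm_num)
    have h3 := hm_add t 1 (s + 1) ht.2.le (by linarith [hs.1]) (by linarith)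
    rw [hm_shift] at h3
    have h4 : m 0 t - m 0 s = m s t := by linarith
    rw [hφΓ s hs, hφΓ t ht, norm_sub_rev, ← AddCircle.coe_sub, h4,
      AddCircle.norm_coe_of_mem_Icc hLpos ⟨hm_nonneg s t, by
        linarith [hm_nonneg 0 s, hm_nonneg t 1]⟩]
    congr 1
    linarith
  have hle : ∀ s ∈ Ico (0 : ℝ) 1, ∀ t ∈ Ico (0 : ℝ) 1, s ≤ t →
      (∃ C ⊆ range Γ, IsPreconnected C ∧ Γ s ∈ C ∧ Γ t ∈ C ∧
        μH[1] C = ENNReal.ofReal ‖φ (Γ s) - φ (Γ t)‖) ∧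
      ∀ C ⊆ range Γ, IsPreconnected C → Γ s ∈ C → Γ t ∈ C →
        ENNReal.ofReal ‖φ (Γ s) - φ (Γ t)‖ ≤ μH[1] C := by
    intro s hs t ht hst
    rw [hnorm s hs t ht hst]
    have hts : t ≤ s + 1 := by linarith [hs.1, ht.2]
    constructor
    · rcases min_choice (m s t) (m t (s + 1)) with h | h <;> rw [h, ← hm_ofReal]
      · exact ⟨_, image_subset_range _ _, isPreconnected_Icc.image Γ hc.continuousOn,
          ⟨s, left_mem_Icc.2 hst, rfl⟩, ⟨t, right_mem_Icc.2 hst, rfl⟩, rfl⟩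
      · exact ⟨_, image_subset_range _ _, isPreconnected_Icc.image Γ hc.continuousOn,
          ⟨s + 1, right_mem_Icc.2 hts, hper s⟩, ⟨t, left_mem_Icc.2 hts, rfl⟩, rfl⟩
    · intro C hCS hC hsC htC
      rcases arc_subset_of_isPreconnected hc hper hinj hC hCS hsC htC with h | h
      · exact (ENNReal.ofReal_le_ofReal (min_le_left _ _)).trans
          (hm_ofReal s t ▸ hausdorffMeasure_image_Icc_le h)
      · exact (ENNReal.ofReal_le_ofReal (min_le_right _ _)).trans
          (hm_ofReal t (s + 1) ▸ hausdorffMeasure_image_Icc_le h)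
  refine ⟨L, φ, fun x hx y hy => ?_⟩
  have hparam : ∀ z ∈ range Γ, ∃ t ∈ Ico (0 : ℝ) 1, Γ t = z := by
    rintro _ ⟨t, rfl⟩
    exact ⟨_, ⟨Int.fract_nonneg t, Int.fract_lt_one t⟩, apply_fract_of_periodic hper t⟩
  obtain ⟨s, hs, rfl⟩ := hparam x hx
  obtain ⟨t, ht, rfl⟩ := hparam y hy
  rcases le_total s t with hst | hts
  · exact hle s hs t ht hst
  · rw [norm_sub_rev]
    obtain ⟨⟨C, hCS, hC, h1, h2, h3⟩, h4⟩ := hle t ht s hs hts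
    exact ⟨⟨C, hCS, hC, h2, h1, h3⟩, fun C hCS hC h1 h2 => h4 C hCS hC h2 h1⟩

/-- Two isometries preserving a rectifiable closed embedded curve commute along it, unless one of
them restricts to an involution of the curve. -/
theorem involutive_or_commute_on_closed_curve {K : ℝ≥0} (hΓ : LipschitzWith K Γ)
    (hper : Function.Periodic Γ 1) (hinj : InjOn Γ (Ico 0 1)) {e f : X ≃ᵢ X}
    (he : e '' range Γ = range Γ) (hf : f '' range Γ = range Γ) :
    (∀ x ∈ range Γ, e (e x) = x) ∨ (∀ x ∈ range Γ, f (f x) = x) ∨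
      ∀ x ∈ range Γ, e (f x) = f (e x) := by
  obtain ⟨L, φ, hφ⟩ := exists_arcLength_coordinate hΓ hper hinj
  have hφinj : InjOn φ (range Γ) := by
    intro x hx y hy hxy
    obtain ⟨C, -, hC, hxC, hyC, hμ⟩ := (hφ x hx y hy).1
    have h := ofReal_dist_le_hausdorffMeasure hC hxC hyC
    rw [hμ, hxy, sub_self, norm_zero, ENNReal.ofReal_zero, nonpos_iff_eq_zero,
      ENNReal.ofReal_eq_zero] at h
    exact dist_le_zero.1 h
  have hmaps : ∀ g : X ≃ᵢ X, g '' range Γ = range Γ → MapsTo g (range Γ) (range Γ) :=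
    fun g hg => mapsTo_iff_image_subset.2 hg.subset
  have hnonexp : ∀ g : X ≃ᵢ X, g '' range Γ = range Γ → ∀ x ∈ range Γ, ∀ y ∈ range Γ,
      ‖φ (g x) - φ (g y)‖ ≤ ‖φ x - φ y‖ := by
    intro g hg x hx y hy
    obtain ⟨C, hCS, hC, hxC, hyC, hμ⟩ := (hφ x hx y hy).1
    have h := (hφ _ (hmaps g hg hx) _ (hmaps g hg hy)).2 (g '' C) ((image_mono hCS).trans hg.subset)
      (hC.image g g.continuous.continuousOn) (mem_image_of_mem g hxC) (mem_image_of_mem g hyC)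
    rwa [g.hausdorffMeasure_image, hμ, ENNReal.ofReal_le_ofReal_iff (norm_nonneg _)] at h
  have hpres : ∀ g : X ≃ᵢ X, g '' range Γ = range Γ → ∀ x ∈ range Γ, ∀ y ∈ range Γ,
      ‖φ (g x) - φ (g y)‖ = ‖φ x - φ y‖ := by
    intro g hg x hx y hy
    refine le_antisymm (hnonexp g hg x hx y hy) ?_
    have hg' : g.symm '' range Γ = range Γ := by
      nth_rewrite 1 [← hg]
      rw [image_image]
      simp
    simpa using hnonexp g.symm hg' _ (hmaps g hg hx) _ (hmaps g hg hy)
  have hinvol : ∀ g : X ≃ᵢ X, g '' range Γ = range Γ → ∀ c, (∀ x ∈ range Γ, φ (g x) = -φ x + c) →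
      ∀ x ∈ range Γ, g (g x) = x := by
    intro g hg c hc x hx
    apply hφinj (hmaps g hg (hmaps g hg hx)) hx
    rw [hc _ (hmaps g hg hx), hc x hx]
    abel
  obtain ⟨c, hc | hc⟩ := exists_rotation_or_reflection (range_nonempty Γ) (hpres e he)
  · obtain ⟨d, hd | hd⟩ := exists_rotation_or_reflection (range_nonempty Γ) (hpres f hf)
    · refine Or.inr (Or.inr fun x hx => ?_)
      apply hφinj (hmaps e he (hmaps f hf hx)) (hmaps f hf (hmaps e he hx))
      rw [hc _ (hmaps f hf hx), hd x hx, hd _ (hmaps e he hx), hc x hx]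
      abel
    · exact Or.inr (Or.inl (hinvol f hf d hd))
  · exact Or.inl (hinvol e he c hc)

end ClosedCurve

theorem not_injOn_of_continuous_of_periodic {g : ℝ → ℝ} (hg : Continuous g)
    (hper : Function.Periodic g 1) : ¬ InjOn g (Ico 0 1) := by
  intro hinj
  have h1 : g 1 = g 0 := by simpa using hper 0
  have hsub₁ := intermediate_value_uIcc (a := (0 : ℝ)) (b := 1 / 2) hg.continuousOn
  have hsub₂ := intermediate_value_uIcc (a := (1 / 2 : ℝ)) (b := 1) hg.continuousOn
  set c := (g 0 + g (1 / 2)) / 2 with hc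
  have hne : g 0 ≠ g (1 / 2) := fun h => by
    have := hinj ⟨le_rfl, one_pos⟩ ⟨by norm_num, by norm_num⟩ h
    norm_num at this
  have hc₁ : c ∈ uIcc (g 0) (g (1 / 2)) := by
    rw [mem_uIcc]
    rcases le_total (g 0) (g (1 / 2)) with h | h
    · left; constructor <;> linarith
    · right; constructor <;> linarith
  have hc₂ : c ∈ uIcc (g (1 / 2)) (g 1) := by rwa [h1, uIcc_comm]
  obtain ⟨s, hs, hsc⟩ := hsub₁ hc₁
  obtain ⟨t, ht, htc⟩ := hsub₂ hc₂
  rw [uIcc_of_le (by norm_num)] at hs ht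
  have ht1 : t ≠ 1 := by
    rintro rfl
    exact hne (by linarith)
  have hst : s = t := hinj ⟨hs.1, by linarith [hs.2]⟩
    ⟨by linarith [ht.1], lt_of_le_of_ne ht.2 ht1⟩ (hsc.trans htc.symm)
  have hs2 : s = 1 / 2 := by linarith [hs.2, ht.1]
  rw [hs2] at hsc
  exact hne (by linarith)

theorem not_range_subset_affLine {Γ : ℝ → EuclideanSpace ℝ (Fin 3)} (hc : Continuous Γ)
    (hper : Function.Periodic Γ 1) (hinj : InjOn Γ (Ico 0 1)) {p u : EuclideanSpace ℝ (Fin 3)}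
    (hu : ‖u‖ = 1) : ¬ range Γ ⊆ affLine p u := by
  intro h
  have hpar : ∀ t, Γ t = p + ⟪u, Γ t - p⟫ • u := by
    intro t
    obtain ⟨c, hct⟩ := h (mem_range_self t)
    rw [hct, add_sub_cancel_left, real_inner_smul_right, real_inner_self_eq_norm_sq, hu, one_pow,
      mul_one]
  refine not_injOn_of_continuous_of_periodic (g := fun t => ⟪u, Γ t - p⟫) (by fun_prop)
    (fun t => by simp only [hper t]) fun s hs t ht hst => hinj hs ht ?_
  rw [hpar s, hpar t]
  exact congrArg (fun r : ℝ => p + r • u) hst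

/-- a closed embedded curve (1-periodic Lipschitz, injective on `[0,1)`,
of positive length) cannot have two distinct axes of rotational symmetry with rotational
angle `2π/a`, `a ≥ 3`. -/
theorem unique_rotation_axis
    (a : ℕ) (ha : 3 ≤ a)
    (Γ : ℝ → EuclideanSpace ℝ (Fin 3)) (K : NNReal) (hΓlip : LipschitzWith K Γ)
    (hΓper : Function.Periodic Γ 1) (hΓinj : Set.InjOn Γ (Set.Ico 0 1))
    (hlen : 0 < ∫ τ in (0:ℝ)..1, ‖deriv Γ τ‖)
    (p₁ u₁ p₂ u₂ : EuclideanSpace ℝ (Fin 3)) (hu₁ : ‖u₁‖ = 1) (hu₂ : ‖u₂‖ = 1)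
    (hsym₁ : rotLine (2 * Real.pi / a) p₁ u₁ '' Set.range Γ = Set.range Γ)
    (hsym₂ : rotLine (2 * Real.pi / a) p₂ u₂ '' Set.range Γ = Set.range Γ) :
    affLine p₁ u₁ = affLine p₂ u₂ := by
  have hs : sin (2 * Real.pi / a) ≠ 0 := by
    have ha' : (3 : ℝ) ≤ a := by exact_mod_cast ha
    refine (sin_pos_of_pos_of_lt_pi (by positivity) ?_).ne'
    rw [div_lt_iff₀ (by positivity)]
    nlinarith [Real.pi_pos]
  have hline : ∀ p u : EuclideanSpace ℝ (Fin 3), ‖u‖ = 1 → ¬ range Γ ⊆ affLine p u :=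
    fun p u hu => not_range_subset_affLine hΓlip.continuous hΓper hΓinj hu
  rcases involutive_or_commute_on_closed_curve hΓlip hΓper hΓinj
    (e := rotLineEquiv (2 * Real.pi / a) p₁ hu₁) (f := rotLineEquiv (2 * Real.pi / a) p₂ hu₂)
    hsym₁ hsym₂ with h | h | h
  · exact absurd (fun x hx => mem_affLine_of_rotLine_rotLine hu₁ hs (h x hx)) (hline p₁ u₁ hu₁)
  · exact absurd (fun x hx => mem_affLine_of_rotLine_rotLine hu₂ hs (h x hx)) (hline p₂ u₂ hu₂)
  · exact affLine_eq_of_rotLine_commute hu₁ hu₂ hs (mapsTo_iff_image_subset.2 hsym₁.subset)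
      (mapsTo_iff_image_subset.2 hsym₂.subset) (hline p₁ u₁ hu₁) (hline p₂ u₂ hu₂) h
end
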